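/- Let (Q,R) be a gentle presentation and let T be a spanning tree of the quiver Q. The degree-1 cohomology of the complex k(Γ∥B) is freely generated by the cohomology classes of: (i) the pairs (c,c) with c an arrow in Q_1 ∖ T; (ii) the pairs (c,α) with c a Γ-maximal arrow and α ∈ B a path neither beginning nor ending with c; (iii) the pairs (c,cδ) with δ ∈ Crep(B) and c the first arrow of δ; (iv) if the characteristic of k is 2, the pairs (b,s(b)) with b a loop such that b² ∈ R. (The paper identifies this cohomology with HH^1(kQ/⟨R⟩).) -/

import Mathlib

/-!
Common framework: quivers, paths (as a start vertex together with a list of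
composable arrows, listed in order of traversal, so that the paper's path
`c_m ⋯ c_1` corresponds to the list `[c_1, …, c_m]`), gentle and quadratic
monomial presentations, the cochain complex `k(Γ ∥ B)` and the chain complex
`k(B ⊙ Γ)` of the paper.
-/

namespace GentleTT

structure Quiv where
  V : Type
  A : Type
  [fintV : Fintype V]
  [fintA : Fintype A]
  [decV : DecidableEq V]
  [decA : DecidableEq A]
  src : A → V
  tgt : A → V

attribute [instance] Quiv.fintV Quiv.fintA Quiv.decV Quiv.decA

/-- A "path datum": a start vertex together with the list of arrows traversed. -/
abbrev PathDat (Q : Quiv) := Q.V × List Q.A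

def psrc (Q : Quiv) (p : PathDat Q) : Q.V := p.1

def ptgt (Q : Quiv) (p : PathDat Q) : Q.V := p.2.getLast?.elim p.1 Q.tgt

def plen (Q : Quiv) (p : PathDat Q) : ℕ := p.2.length

/-- `p` is a genuine path: consecutive arrows compose, and the recorded start
vertex is the source of the first arrow (if any). -/
def Ok (Q : Quiv) (p : PathDat Q) : Prop :=
  p.2.Chain' (fun a b => Q.tgt a = Q.src b) ∧ ∀ a ∈ p.2.head?, Q.src a = p.1

/-- `p` is a path none of whose length-2 subpaths lies in `R`
(an element of the basis `B` of `kQ/⟨R⟩`). -/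
def InB (Q : Quiv) (R : Set (Q.A × Q.A)) (p : PathDat Q) : Prop :=
  Ok Q p ∧ p.2.Chain' (fun a b => (a, b) ∉ R)

/-- `p` is a path all of whose length-2 subpaths lie in `R` (an element of `Γ`). -/
def InG (Q : Quiv) (R : Set (Q.A × Q.A)) (p : PathDat Q) : Prop :=
  Ok Q p ∧ p.2.Chain' (fun a b => (a, b) ∈ R)

/-- Parallel paths: same source and same target. -/
def Par (Q : Quiv) (p q : PathDat Q) : Prop :=
  psrc Q p = psrc Q q ∧ ptgt Q p = ptgt Q q

/-- Antiparallel paths: `s(p) = t(q)` and `t(p) = s(q)`. -/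
def AntiPar (Q : Quiv) (p q : PathDat Q) : Prop :=
  psrc Q p = ptgt Q q ∧ ptgt Q p = psrc Q q

/-- A cycle: a path of positive length whose source equals its target. -/
def IsCycle (Q : Quiv) (p : PathDat Q) : Prop :=
  Ok Q p ∧ p.2 ≠ [] ∧ psrc Q p = ptgt Q p

/-- Rotation of a cycle: the paper's `rot (c_m ⋯ c_1) = c_{m-1} ⋯ c_1 c_m`
(the last arrow traversed becomes the first one traversed). -/
def rotP (Q : Quiv) (p : PathDat Q) : PathDat Q :=
  match p.2.getLast? with
  | none => p
  | some a => (Q.src a, a :: p.2.dropLast)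

/-- Iterated rotation `rot^i`. -/
def rotI (Q : Quiv) (i : ℕ) (p : PathDat Q) : PathDat Q := (rotP Q)^[i] p

def powL {α : Type} (l : List α) : ℕ → List α
  | 0 => []
  | n + 1 => l ++ powL l n

/-- The `n`-th power `p^n` of a (cyclic) path. -/
def powP (Q : Quiv) (p : PathDat Q) (n : ℕ) : PathDat Q := (p.1, powL p.2 n)

/-- A primitive cycle: a cycle that is not a proper power of another cycle. -/
def IsPrimitive (Q : Quiv) (p : PathDat Q) : Prop :=
  IsCycle Q p ∧ ∀ (q : PathDat Q) (n : ℕ), IsCycle Q q → 2 ≤ n → p ≠ powP Q q n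

/-- The period of a cycle: the least `i ≥ 1` with `rot^i p = p`. -/
noncomputable def periodP (Q : Quiv) (p : PathDat Q) : ℕ :=
  sInf {i : ℕ | 1 ≤ i ∧ rotI Q i p = p}

/-- Two cycles are conjugate (belong to the same circuit) if one is obtained
from the other by iterated rotation. -/
def RotEquiv (Q : Quiv) (p q : PathDat Q) : Prop := ∃ i : ℕ, rotI Q i p = q

/-- A cocomplete cycle: `p² ∈ B`. -/
def Cocomplete (Q : Quiv) (R : Set (Q.A × Q.A)) (p : PathDat Q) : Prop :=
  IsCycle Q p ∧ InB Q R (powP Q p 2)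

/-- A complete cycle: `p² ∈ Γ`. -/
def Complete (Q : Quiv) (R : Set (Q.A × Q.A)) (p : PathDat Q) : Prop :=
  IsCycle Q p ∧ InG Q R (powP Q p 2)

/-- `B`-maximal path: in `B` and not a proper subpath of another element of `B`. -/
def BMax (Q : Quiv) (R : Set (Q.A × Q.A)) (p : PathDat Q) : Prop :=
  InB Q R p ∧ ∀ q : PathDat Q, InB Q R q → p.2 <:+: q.2 → p.2 = q.2

/-- `Γ`-maximal path: in `Γ` and not a proper subpath of another element of `Γ`. -/
def GMax (Q : Quiv) (R : Set (Q.A × Q.A)) (p : PathDat Q) : Prop :=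
  InG Q R p ∧ ∀ q : PathDat Q, InG Q R q → p.2 <:+: q.2 → p.2 = q.2

def Adj (Q : Quiv) (v w : Q.V) : Prop :=
  ∃ a : Q.A, (Q.src a = v ∧ Q.tgt a = w) ∨ (Q.src a = w ∧ Q.tgt a = v)

/-- Connectedness of the underlying graph of the quiver. -/
def Connected (Q : Quiv) : Prop := ∀ v w : Q.V, Relation.ReflTransGen (Adj Q) v w

/-- A quadratic monomial presentation: the relations are paths of length 2. -/
def IsQuadMon (Q : Quiv) (R : Set (Q.A × Q.A)) : Prop :=
  ∀ r ∈ R, Q.tgt r.1 = Q.src r.2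

/-- A gentle presentation. -/
structure IsGentle (Q : Quiv) (R : Set (Q.A × Q.A)) : Prop where
  nonempty : Nonempty Q.V
  connected : Connected Q
  relComposable : ∀ r ∈ R, Q.tgt r.1 = Q.src r.2
  srcLe : ∀ v : Q.V, {a : Q.A | Q.src a = v}.ncard ≤ 2
  tgtLe : ∀ v : Q.V, {a : Q.A | Q.tgt a = v}.ncard ≤ 2
  uniqNotRelAfter : ∀ a : Q.A, {b : Q.A | Q.tgt a = Q.src b ∧ (a, b) ∉ R}.Subsingleton
  uniqNotRelBefore : ∀ a : Q.A, {c : Q.A | Q.tgt c = Q.src a ∧ (c, a) ∉ R}.Subsingleton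
  uniqRelAfter : ∀ a : Q.A, {b : Q.A | Q.tgt a = Q.src b ∧ (a, b) ∈ R}.Subsingleton
  uniqRelBefore : ∀ a : Q.A, {c : Q.A | Q.tgt c = Q.src a ∧ (c, a) ∈ R}.Subsingleton

/-- A spanning tree of the (finite, connected) quiver `Q`: a set of arrows
which connects all vertices and has exactly `|Q₀| - 1` elements. -/
def IsSpanningTree (Q : Quiv) (T : Set Q.A) : Prop :=
  (∀ v w : Q.V, Relation.ReflTransGen
      (fun x y => ∃ a ∈ T, (Q.src a = x ∧ Q.tgt a = y) ∨ (Q.src a = y ∧ Q.tgt a = x)) v w) ∧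
  T.ncard + 1 = Fintype.card Q.V

/-- A set of representatives, one for each rotation class of cycles
satisfying `Pred`. -/
def IsRepSet (Q : Quiv) (P : Set (PathDat Q)) (Pred : PathDat Q → Prop) : Prop :=
  (∀ p ∈ P, Pred p) ∧ ∀ q : PathDat Q, Pred q → ∃! p, p ∈ P ∧ RotEquiv Q q p

/-- `S` is a valid choice of the paper's set `Crep` for the predicate `Pred`
(e.g. cocompleteness, or completeness): it consists of all positive powers of a
chosen set of representatives of the rotation classes of primitive cycles
satisfying `Pred`. -/
def IsCrep (Q : Quiv) (S : Set (PathDat Q)) (Pred : PathDat Q → Prop) : Prop :=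
  ∃ P : Set (PathDat Q),
    IsRepSet Q P (fun p => IsPrimitive Q p ∧ Pred p) ∧
    S = {x | ∃ p ∈ P, ∃ n : ℕ, 1 ≤ n ∧ x = powP Q p n}

/-! ### The cochain complex `k(Γ ∥ B)` -/

/-- Membership in the degree-`m` basis `Γ_m ∥ B` of the cochain complex. -/
def GBmem (Q : Quiv) (R : Set (Q.A × Q.A)) (m : ℕ) (x : PathDat Q × PathDat Q) : Prop :=
  InG Q R x.1 ∧ plen Q x.1 = m ∧ InB Q R x.2 ∧ Par Q x.1 x.2

abbrev GB (Q : Quiv) (R : Set (Q.A × Q.A)) (m : ℕ) :=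
  {x : PathDat Q × PathDat Q // GBmem Q R m x}

/-- The degree-`m` component of the cochain complex `k(Γ ∥ B)`. -/
abbrev Coch (k : Type) [Field k] (Q : Quiv) (R : Set (Q.A × Q.A)) (m : ℕ) :=
  GB Q R m →₀ k

/-- The basis vector of `k(Γ_m ∥ B)` attached to a raw pair of path data
(and `0` if the pair is not in `Γ_m ∥ B`). -/
noncomputable def bv (k : Type) [Field k] (Q : Quiv) (R : Set (Q.A × Q.A)) (m : ℕ)
    (x : PathDat Q × PathDat Q) : Coch k Q R m := by
  classical
  exact if h : GBmem Q R m x then Finsupp.single (⟨x, h⟩ : GB Q R m) (1 : k) else 0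

/-- Extension on the left (in the paper's notation): `p ↦ b p`. -/
def extL (Q : Quiv) (b : Q.A) (p : PathDat Q) : PathDat Q := (p.1, p.2 ++ [b])

/-- Extension on the right (in the paper's notation): `p ↦ p a`. -/
def extR (Q : Quiv) (a : Q.A) (p : PathDat Q) : PathDat Q := (Q.src a, a :: p.2)

/-- The differential on a basis element:
`d^m (γ, α) = Σ_b (bγ, bα) - (-1)^m Σ_a (γa, αa)`. -/
noncomputable def dB (k : Type) [Field k] (Q : Quiv) (R : Set (Q.A × Q.A)) (m : ℕ)
    (x : GB Q R m) : Coch k Q R (m + 1) := by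
  classical
  exact
    (∑ b : Q.A,
      if h : GBmem Q R (m + 1) (extL Q b x.val.1, extL Q b x.val.2) then
        Finsupp.single (⟨_, h⟩ : GB Q R (m + 1)) (1 : k) else 0)
    - ((-1 : k) ^ m) •
      (∑ a : Q.A,
        if h : Q.tgt a = psrc Q x.val.1 ∧
            GBmem Q R (m + 1) (extR Q a x.val.1, extR Q a x.val.2) then
          Finsupp.single (⟨_, h.2⟩ : GB Q R (m + 1)) (1 : k) else 0)

/-- The differential `d^m : k(Γ_m ∥ B) → k(Γ_{m+1} ∥ B)`. -/
noncomputable def dLin (k : Type) [Field k] (Q : Quiv) (R : Set (Q.A × Q.A)) (m : ℕ) :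
    Coch k Q R m →ₗ[k] Coch k Q R (m + 1) :=
  Finsupp.linearCombination k (dB k Q R m)

/-- The element `𝟙 = Σ_{i ∈ Q₀} (e_i, e_i)` (placed in degree `m`; it is the
intended element when `m = 0`). -/
noncomputable def oneD (k : Type) [Field k] (Q : Quiv) (R : Set (Q.A × Q.A)) (m : ℕ) :
    Coch k Q R m :=
  ∑ i : Q.V, bv k Q R m ((i, []), (i, []))

/-- `⟨α⟩ = Σ_{i=0}^{r-1} (s(rot^i α), rot^i α)`, `r` the period of `α`. -/
noncomputable def cycB (k : Type) [Field k] (Q : Quiv) (R : Set (Q.A × Q.A)) (m : ℕ)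
    (α : PathDat Q) : Coch k Q R m :=
  ∑ i ∈ Finset.range (periodP Q α),
    bv k Q R m ((psrc Q (rotI Q i α), []), rotI Q i α)

/-- `⟨C⟩ = Σ_{i=0}^{r-1} (-1)^{i m} (rot^i C, s(rot^i C))`, `r` the period of `C`. -/
noncomputable def cycG (k : Type) [Field k] (Q : Quiv) (R : Set (Q.A × Q.A)) (m : ℕ)
    (C : PathDat Q) : Coch k Q R m :=
  ∑ i ∈ Finset.range (periodP Q C),
    ((-1 : k) ^ (i * m)) • bv k Q R m (rotI Q i C, (psrc Q (rotI Q i C), []))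

/-- The coboundary subspace in degree `m` (zero in degree `0`). -/
noncomputable def cobSp (k : Type) [Field k] (Q : Quiv) (R : Set (Q.A × Q.A)) :
    (m : ℕ) → Submodule k (Coch k Q R m)
  | 0 => ⊥
  | m + 1 => LinearMap.range (dLin k Q R m)

/-- The cocycle subspace in degree `m`. -/
noncomputable def cocSp (k : Type) [Field k] (Q : Quiv) (R : Set (Q.A × Q.A)) (m : ℕ) :
    Submodule k (Coch k Q R m) :=
  LinearMap.ker (dLin k Q R m)

/-- The degree-`m` cohomology `HH^m` of the complex `k(Γ ∥ B)` vanishes: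
every cocycle is a coboundary. -/
def CohomIsZero (k : Type) [Field k] (Q : Quiv) (R : Set (Q.A × Q.A)) (m : ℕ) : Prop :=
  cocSp k Q R m ≤ cobSp k Q R m

/-- The degree-`m` cohomology `HH^m` of the complex `k(Γ ∥ B)` is
finite-dimensional: there is a finite set of cocycles whose classes span it. -/
def CohomFinDim (k : Type) [Field k] (Q : Quiv) (R : Set (Q.A × Q.A)) (m : ℕ) : Prop :=
  ∃ G : Finset (Coch k Q R m), ↑G ⊆ (cocSp k Q R m : Set (Coch k Q R m)) ∧
    cocSp k Q R m ≤ cobSp k Q R m ⊔ Submodule.span k ↑G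

/-- The degree-`m` cohomology `HH^m` of the complex `k(Γ ∥ B)` has dimension at
most `n`: there are `n` cocycles whose classes span it. -/
def CohomDimLe (k : Type) [Field k] (Q : Quiv) (R : Set (Q.A × Q.A)) (m n : ℕ) : Prop :=
  ∃ G : Finset (Coch k Q R m), G.card ≤ n ∧
    ↑G ⊆ (cocSp k Q R m : Set (Coch k Q R m)) ∧
    cocSp k Q R m ≤ cobSp k Q R m ⊔ Submodule.span k ↑G

/-- `Gen` is a basis of the kernel of `d⁰`, i.e. it freely generates `HH⁰`. -/
def FreelyGeneratesKer0 (k : Type) [Field k] (Q : Quiv) (R : Set (Q.A × Q.A))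
    (Gen : Set (Coch k Q R 0)) : Prop :=
  (∀ x ∈ Gen, dLin k Q R 0 x = 0) ∧
  (∀ z : Coch k Q R 0, dLin k Q R 0 z = 0 → z ∈ Submodule.span k Gen) ∧
  LinearIndependent k (fun x : Gen => (x : Coch k Q R 0))

/-- The cohomology classes of the elements of `Gen` freely generate the
degree-`(m+1)` cohomology of `k(Γ ∥ B)`: all elements of `Gen` are cocycles,
every cocycle is congruent to an element of their span modulo coboundaries, no
nonzero element of their span is a coboundary, and `Gen` is linearly
independent. -/
def FreelyGeneratesCohom (k : Type) [Field k] (Q : Quiv) (R : Set (Q.A × Q.A)) (m : ℕ)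
    (Gen : Set (Coch k Q R (m + 1))) : Prop :=
  (∀ x ∈ Gen, dLin k Q R (m + 1) x = 0) ∧
  (∀ z : Coch k Q R (m + 1), dLin k Q R (m + 1) z = 0 →
      ∃ y : Coch k Q R m, z - dLin k Q R m y ∈ Submodule.span k Gen) ∧
  (∀ x ∈ Submodule.span k Gen, x ∈ LinearMap.range (dLin k Q R m) → x = 0) ∧
  LinearIndependent k (fun x : Gen => (x : Coch k Q R (m + 1)))

/-! ### The chain complex `k(B ⊙ Γ)` -/

/-- Membership in the degree-`m` basis `B ⊙ Γ_m` of the chain complex. -/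
def BGmem (Q : Quiv) (R : Set (Q.A × Q.A)) (m : ℕ) (x : PathDat Q × PathDat Q) : Prop :=
  InB Q R x.1 ∧ InG Q R x.2 ∧ plen Q x.2 = m ∧ AntiPar Q x.1 x.2

abbrev BGt (Q : Quiv) (R : Set (Q.A × Q.A)) (m : ℕ) :=
  {x : PathDat Q × PathDat Q // BGmem Q R m x}

/-- The degree-`m` component of the chain complex `k(B ⊙ Γ)`. -/
abbrev Chn (k : Type) [Field k] (Q : Quiv) (R : Set (Q.A × Q.A)) (m : ℕ) :=
  BGt Q R m →₀ k

/-- The basis vector of `k(B ⊙ Γ_m)` attached to a raw pair of path data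
(and `0` if the pair is not in `B ⊙ Γ_m`). -/
noncomputable def bw (k : Type) [Field k] (Q : Quiv) (R : Set (Q.A × Q.A)) (m : ℕ)
    (x : PathDat Q × PathDat Q) : Chn k Q R m := by
  classical
  exact if h : BGmem Q R m x then Finsupp.single (⟨x, h⟩ : BGt Q R m) (1 : k) else 0

/-- `l1(p)`: the last arrow of `p` (as a path of length one). -/
def l1P (Q : Quiv) (p : PathDat Q) : PathDat Q :=
  match p.2.getLast? with
  | none => p
  | some a => (Q.src a, [a])

/-- `l2(p)`: `p` with its last arrow removed. -/
def l2P (Q : Quiv) (p : PathDat Q) : PathDat Q := (p.1, p.2.dropLast)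

/-- `r1(p)`: `p` with its first arrow removed. -/
def r1P (Q : Quiv) (p : PathDat Q) : PathDat Q :=
  match p.2 with
  | [] => p
  | a :: l => (Q.tgt a, l)

/-- `r2(p)`: the first arrow of `p` (as a path of length one). -/
def r2P (Q : Quiv) (p : PathDat Q) : PathDat Q :=
  match p.2 with
  | [] => p
  | a :: _ => (Q.src a, [a])

/-- The raw first term `(α·l1(γ), l2(γ))` of the boundary of `(α, γ)`. -/
def d1raw (Q : Quiv) (x : PathDat Q × PathDat Q) : PathDat Q × PathDat Q :=
  match x.2.2.getLast? with
  | none => x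
  | some a => ((Q.src a, a :: x.1.2), (x.2.1, x.2.2.dropLast))

/-- The raw second term `(r2(γ)·α, r1(γ))` of the boundary of `(α, γ)`. -/
def d2raw (Q : Quiv) (x : PathDat Q × PathDat Q) : PathDat Q × PathDat Q :=
  match x.2.2 with
  | [] => x
  | c :: l => ((x.1.1, x.1.2 ++ [c]), (Q.tgt c, l))

/-- The boundary of a basis element:
`d_m (α, γ) = (α·l1(γ), l2(γ)) + (-1)^m (r2(γ)·α, r1(γ))` (in degree `m = m+1`),
where pairs whose first component is not in `B` are interpreted as `0`. -/
noncomputable def bdB (k : Type) [Field k] (Q : Quiv) (R : Set (Q.A × Q.A)) (m : ℕ)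
    (x : BGt Q R (m + 1)) : Chn k Q R m :=
  bw k Q R m (d1raw Q x.val) + ((-1 : k) ^ (m + 1)) • bw k Q R m (d2raw Q x.val)

/-- The boundary map `d_{m+1} : k(B ⊙ Γ_{m+1}) → k(B ⊙ Γ_m)`. -/
noncomputable def bd (k : Type) [Field k] (Q : Quiv) (R : Set (Q.A × Q.A)) (m : ℕ) :
    Chn k Q R (m + 1) →ₗ[k] Chn k Q R m :=
  Finsupp.linearCombination k (bdB k Q R m)

/-- The subspace of cycles in degree `m` (everything in degree `0`). -/
noncomputable def ZSp (k : Type) [Field k] (Q : Quiv) (R : Set (Q.A × Q.A)) :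
    (m : ℕ) → Submodule k (Chn k Q R m)
  | 0 => ⊤
  | m + 1 => LinearMap.ker (bd k Q R m)

/-- The subspace of boundaries in degree `m`. -/
noncomputable def BSp (k : Type) [Field k] (Q : Quiv) (R : Set (Q.A × Q.A)) (m : ℕ) :
    Submodule k (Chn k Q R m) :=
  LinearMap.range (bd k Q R m)

/-- The degree-`m` homology `HH_m` of the complex `k(B ⊙ Γ)` vanishes:
every cycle is a boundary. -/
def HomIsZero (k : Type) [Field k] (Q : Quiv) (R : Set (Q.A × Q.A)) (m : ℕ) : Prop :=
  ZSp k Q R m ≤ BSp k Q R m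

/-- The degree-`m` homology `HH_m` of the complex `k(B ⊙ Γ)` is
finite-dimensional: there is a finite set of cycles whose classes span it. -/
def HomFinDim (k : Type) [Field k] (Q : Quiv) (R : Set (Q.A × Q.A)) (m : ℕ) : Prop :=
  ∃ G : Finset (Chn k Q R m), ↑G ⊆ (ZSp k Q R m : Set (Chn k Q R m)) ∧
    ZSp k Q R m ≤ BSp k Q R m ⊔ Submodule.span k ↑G

/-- The concatenation `α γ` of an antiparallel pair (a cycle, or a trivial path). -/
def concatP (Q : Quiv) (x : PathDat Q × PathDat Q) : PathDat Q := (x.2.1, x.2.2 ++ x.1.2)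

/-- The degree-`m` component of the subcomplex `k(B ⊙ Γ)_C`, spanned by the
basis elements whose concatenation lies in the circuit (rotation class) of `c`. -/
noncomputable def Wsp (k : Type) [Field k] (Q : Quiv) (R : Set (Q.A × Q.A))
    (c : PathDat Q) (m : ℕ) : Submodule k (Chn k Q R m) :=
  Submodule.span k {z : Chn k Q R m |
    ∃ x : BGt Q R m, RotEquiv Q (concatP Q x.val) c ∧ z = Finsupp.single x (1 : k)}

/-- The boundaries of the subcomplex `k(B ⊙ Γ)_C` in degree `m`. -/
noncomputable def WB (k : Type) [Field k] (Q : Quiv) (R : Set (Q.A × Q.A))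
    (c : PathDat Q) (m : ℕ) : Submodule k (Chn k Q R m) :=
  Submodule.map (bd k Q R m) (Wsp k Q R c (m + 1))

/-- The cycles of the subcomplex `k(B ⊙ Γ)_C` in degree `m`. -/
noncomputable def WZ (k : Type) [Field k] (Q : Quiv) (R : Set (Q.A × Q.A))
    (c : PathDat Q) (m : ℕ) : Submodule k (Chn k Q R m) :=
  ZSp k Q R m ⊓ Wsp k Q R c m

/-- The degree-`m` homology of `k(B ⊙ Γ)_C` is one-dimensional, spanned by the
homology class of `v`. -/
def SubHomSpannedBy (k : Type) [Field k] (Q : Quiv) (R : Set (Q.A × Q.A))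
    (c : PathDat Q) (m : ℕ) (v : Chn k Q R m) : Prop :=
  v ∈ WZ k Q R c m ∧ v ∉ WB k Q R c m ∧
  ∀ z ∈ WZ k Q R c m, ∃ t : k, z - t • v ∈ WB k Q R c m

/-- `ĥ(c) = Σ_{i=0}^{r-1} (r1(rot^i c), r2(rot^i c))` (degree 1, for cocomplete cycles;
placed in degree `m`). -/
noncomputable def hCycR (k : Type) [Field k] (Q : Quiv) (R : Set (Q.A × Q.A)) (m : ℕ)
    (c : PathDat Q) : Chn k Q R m :=
  ∑ i ∈ Finset.range (periodP Q c),
    bw k Q R m (r1P Q (rotI Q i c), r2P Q (rotI Q i c))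

/-- `ĥ(c) = Σ_{i=0}^{r-1} (-1)^{(m+1) i} (s(rot^i c), rot^i c)` (degree `m`, for
complete cycles of length `m`). -/
noncomputable def hCycM (k : Type) [Field k] (Q : Quiv) (R : Set (Q.A × Q.A)) (m : ℕ)
    (c : PathDat Q) : Chn k Q R m :=
  ∑ i ∈ Finset.range (periodP Q c),
    ((-1 : k) ^ ((m + 1) * i)) • bw k Q R m ((psrc Q (rotI Q i c), []), rotI Q i c)

/-- The homology classes of the elements of `Gen` freely generate the degree-`m`
homology of `k(B ⊙ Γ)`. -/
def FreelyGeneratesHom (k : Type) [Field k] (Q : Quiv) (R : Set (Q.A × Q.A)) (m : ℕ)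
    (Gen : Set (Chn k Q R m)) : Prop :=
  (∀ x ∈ Gen, x ∈ ZSp k Q R m) ∧
  (∀ z ∈ ZSp k Q R m, ∃ y : Chn k Q R (m + 1), z - bd k Q R m y ∈ Submodule.span k Gen) ∧
  (∀ x ∈ Submodule.span k Gen, x ∈ LinearMap.range (bd k Q R m) → x = 0) ∧
  LinearIndependent k (fun x : Gen => (x : Chn k Q R m))

/-! ### Helper lemmas -/

section Helpers

variable {k : Type} [Field k] {Q : Quiv} {R : Set (Q.A × Q.A)}

/-- Composable pair of arrows whose composite is not a relation. -/
def NR (Q : Quiv) (R : Set (Q.A × Q.A)) (a b : Q.A) : Prop := Q.tgt a = Q.src b ∧ (a, b) ∉ R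

lemma isChain_and {α : Type} {r s : α → α → Prop} (l : List α) :
    l.IsChain (fun a b => r a b ∧ s a b) ↔ l.IsChain r ∧ l.IsChain s := by
  induction l with
  | nil => simp
  | cons a l ih => simp only [List.isChain_cons, ih]; grind

lemma inB_iff (v : Q.V) (l : List Q.A) :
    InB Q R (v, l) ↔ l.IsChain (NR Q R) ∧ ∀ a ∈ l.head?, Q.src a = v := by
  unfold InB Ok
  have := isChain_and (r := fun a b => Q.tgt a = Q.src b) (s := fun a b => (a, b) ∉ R) l
  have h2 : l.IsChain (NR Q R) ↔ _ := this
  rw [h2]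
  simp only [List.Chain']
  tauto

/-- Extended coefficient function. -/
noncomputable def cf (m : ℕ) (z : Coch k Q R m) (x : PathDat Q × PathDat Q) : k := by
  classical
  exact if h : GBmem Q R m x then z ⟨x, h⟩ else 0

lemma cf_pos {m : ℕ} (z : Coch k Q R m) (x : GB Q R m) : cf m z x.val = z x := by
  simp [cf, x.2]

lemma cf_mem {m : ℕ} (z : Coch k Q R m) {x} (h : GBmem Q R m x) : cf m z x = z ⟨x, h⟩ := by
  simp [cf, h]

lemma cf_add {m : ℕ} (z w : Coch k Q R m) (x) : cf m (z + w) x = cf m z x + cf m w x := by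
  unfold cf; split <;> simp

lemma cf_single {m : ℕ} (y : GB Q R m) (r : k) (x) [Decidable (y.val = x)] :
    cf m (Finsupp.single y r) x = if y.val = x then r else 0 := by
  classical
  unfold cf
  split_ifs with h1 h2 h2
  · subst h2; simp
  · rw [Finsupp.single_apply, if_neg]; rintro rfl; exact h2 rfl
  · subst h2; exact absurd y.2 h1
  · rfl

lemma bv_mem {m : ℕ} {x} (h : GBmem Q R m x) :
    bv k Q R m x = Finsupp.single ⟨x, h⟩ 1 := by simp [bv, h]

lemma bv_not {m : ℕ} {x} (h : ¬ GBmem Q R m x) : bv k Q R m x = 0 := by simp [bv, h]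

lemma bv_apply {m : ℕ} (x) (Y : GB Q R m) [Decidable (x = Y.val)] :
    bv k Q R m x Y = if x = Y.val then 1 else 0 := by
  classical
  by_cases h : GBmem Q R m x
  · rw [bv_mem h, Finsupp.single_apply]; congr 1; rw [Subtype.ext_iff]
  · rw [bv_not h, if_neg]; · rfl
    rintro rfl; exact h Y.2

open Classical in
lemma dB_eq {m : ℕ} (x : GB Q R m) : dB k Q R m x =
    (∑ b : Q.A, bv k Q R (m+1) (extL Q b x.val.1, extL Q b x.val.2)) - ((-1 : k) ^ m) •
      (∑ a : Q.A, if Q.tgt a = psrc Q x.val.1 then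
        bv k Q R (m+1) (extR Q a x.val.1, extR Q a x.val.2) else 0) := by
  unfold dB bv
  congr 2
  refine Finset.sum_congr rfl fun a _ => ?_
  split_ifs <;> first | rfl | tauto

open Classical in
lemma dB_apply {m : ℕ} (x : GB Q R m) {v w : Q.V} {g l : List Q.A}
    (hY : GBmem Q R (m+1) ((v, g), (w, l))) {a b : Q.A} {g1 g2 : List Q.A}
    (h1 : g = a :: g1) (h2 : g = g2 ++ [b]) :
    dB k Q R m x ⟨_, hY⟩ =
      (if l.getLast? = some b ∧ x.val = ((v, g2), (w, l.dropLast)) then 1 else 0) -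
      (-1) ^ m * (if l.head? = some a ∧ x.val = ((Q.tgt a, g1), (Q.tgt a, l.tail)) then 1 else 0) := by
  obtain ⟨⟨⟨x1, x2⟩, ⟨x3, x4⟩⟩, hx⟩ := x
  have hsv : Q.src a = v := hY.1.1.2 a (by simp [h1])
  have hvw : v = w := hY.2.2.2.1
  have hx13 : x1 = x3 := hx.2.2.2.1
  have hh : psrc Q ((v,g) : PathDat Q) = v := rfl
  rw [dB_eq]
  simp only [Finsupp.sub_apply, Finsupp.smul_apply, Finsupp.finset_sum_apply, smul_eq_mul]
  congr 2
  · rw [Finset.sum_eq_single b]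
    · rw [bv_apply]
      refine if_congr ?_ rfl rfl
      simp only [extL, Prod.mk.injEq]
      constructor
      · rintro ⟨⟨rfl, h⟩, rfl, rfl⟩
        rw [h2] at h
        simpa using h
      · rintro ⟨h, ⟨rfl, rfl⟩, rfl, rfl⟩
        refine ⟨⟨rfl, h2.symm⟩, rfl, ?_⟩
        rcases List.eq_nil_or_concat l with rfl | ⟨l', c, rfl⟩
        · simp at h
        · simpa using h.symm
    · intro b' _ hb'
      rw [bv_apply, if_neg]
      simp only [extL, Prod.mk.injEq]
      rintro ⟨⟨rfl, h⟩, -⟩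
      rw [h2] at h
      apply hb'
      simpa using congrArg List.getLast? h
    · simp
  · rw [Finset.sum_eq_single a]
    · by_cases h3 : Q.tgt a = psrc Q ((x1, x2) : PathDat Q)
      · rw [if_pos h3, bv_apply]
        change Q.tgt a = x1 at h3
        refine if_congr ?_ rfl rfl
        simp only [extR, Prod.mk.injEq]
        constructor
        · rintro ⟨⟨-, h6⟩, -, h7⟩
          rw [h1] at h6
          simp only [List.cons.injEq, true_and] at h6
          subst h7 h6
          simp [h3, ← hx13]
        · rintro ⟨h5, ⟨rfl, rfl⟩, rfl, rfl⟩
          refine ⟨⟨hsv, h1.symm⟩, hsv.trans hvw, ?_⟩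
          cases l with
          | nil => simp at h5
          | cons => simpa using h5.symm
      · rw [if_neg h3, if_neg]
        · rfl
        · intro h4
          apply h3
          simp only [Prod.mk.injEq] at h4
          exact h4.2.1.1.symm
    · intro b' _ hb'
      split_ifs with h3
      · rw [bv_apply, if_neg]
        simp only [extR, Prod.mk.injEq]
        rintro ⟨⟨-, h⟩, -⟩
        rw [h1] at h
        apply hb'
        simpa using congrArg List.head? h
      · rfl
    · simp

lemma dLin_single {m : ℕ} (x : GB Q R m) (r : k) :
    dLin k Q R m (Finsupp.single x r) = r • dB k Q R m x := by
  simp [dLin]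

open Classical in
lemma d_apply {m : ℕ} (y : Coch k Q R m) {v w : Q.V} {g l : List Q.A}
    (hY : GBmem Q R (m+1) ((v, g), (w, l))) {a b : Q.A} {g1 g2 : List Q.A}
    (h1 : g = a :: g1) (h2 : g = g2 ++ [b]) :
    dLin k Q R m y ⟨_, hY⟩ =
      (if l.getLast? = some b then cf m y ((v, g2), (w, l.dropLast)) else 0) -
      (-1) ^ m * (if l.head? = some a then cf m y ((Q.tgt a, g1), (Q.tgt a, l.tail)) else 0) := by
  induction y using Finsupp.induction_linear with
  | zero => simp [cf]
  | add f g hf hg =>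
    rw [map_add, Finsupp.add_apply, hf, hg]
    simp only [cf_add]
    split_ifs <;> ring
  | single x r =>
    rw [dLin_single, Finsupp.smul_apply, dB_apply x hY h1 h2]
    simp only [cf_single, smul_eq_mul]
    split_ifs <;> first | ring1 | tauto

/-! Degree one data. -/

abbrev pt (Q : Quiv) (v : Q.V) (l : List Q.A) : PathDat Q × PathDat Q := ((v, []), (v, l))
abbrev pr (Q : Quiv) (c : Q.A) (l : List Q.A) : PathDat Q × PathDat Q :=
  ((Q.src c, [c]), (Q.src c, l))
abbrev pr2 (Q : Quiv) (a b : Q.A) (l : List Q.A) : PathDat Q × PathDat Q :=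
  ((Q.src a, [a, b]), (Q.src a, l))

lemma mem0 (v : Q.V) (l : List Q.A) : GBmem Q R 0 (pt Q v l) ↔
    l.IsChain (NR Q R) ∧ (∀ a ∈ l.head?, Q.src a = v) ∧ (∀ b ∈ l.getLast?, Q.tgt b = v) := by
  simp only [GBmem, inB_iff]
  rcases List.eq_nil_or_concat l with rfl | ⟨l', c, rfl⟩
  · simp [InG, Ok, plen, Par, psrc, ptgt, List.Chain']
  · simp [InG, Ok, plen, Par, psrc, ptgt, List.Chain', and_assoc]; grind

lemma mem1 (c : Q.A) (l : List Q.A) : GBmem Q R 1 (pr Q c l) ↔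
    l.IsChain (NR Q R) ∧ (∀ a ∈ l.head?, Q.src a = Q.src c) ∧
      (∀ b ∈ l.getLast?, Q.tgt b = Q.tgt c) ∧ (l = [] → Q.src c = Q.tgt c) := by
  simp only [GBmem, inB_iff]
  rcases List.eq_nil_or_concat l with rfl | ⟨l', d, rfl⟩
  · simp [InG, Ok, plen, Par, psrc, ptgt, List.Chain', eq_comm]
  · simp [InG, Ok, plen, Par, psrc, ptgt, List.Chain', and_assoc]; grind

lemma mem2 (hg : IsGentle Q R) (a b : Q.A) (l : List Q.A) : GBmem Q R 2 (pr2 Q a b l) ↔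
    (a, b) ∈ R ∧ l.IsChain (NR Q R) ∧ (∀ c ∈ l.head?, Q.src c = Q.src a) ∧
      (∀ c ∈ l.getLast?, Q.tgt c = Q.tgt b) ∧ (l = [] → Q.src a = Q.tgt b) := by
  simp only [GBmem, inB_iff]
  have h0 := hg.relComposable (a, b)
  rcases List.eq_nil_or_concat l with rfl | ⟨l', d, rfl⟩
  · simp [InG, Ok, plen, Par, psrc, ptgt, List.Chain']; grind
  · simp [InG, Ok, plen, Par, psrc, ptgt, List.Chain', and_assoc]; grind

lemma exists_pt (x : GB Q R 0) : ∃ v l, x.val = pt Q v l := by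
  obtain ⟨⟨⟨v, g⟩, ⟨w, l⟩⟩, h⟩ := x
  have h1 : g.length = 0 := h.2.1
  have h2 : v = w := h.2.2.2.1
  rw [List.length_eq_zero_iff] at h1
  subst h1 h2
  exact ⟨_, _, rfl⟩

lemma exists_pr (x : GB Q R 1) : ∃ c l, x.val = pr Q c l := by
  obtain ⟨⟨⟨v, g⟩, ⟨w, l⟩⟩, h⟩ := x
  have h1 : g.length = 1 := h.2.1
  have h2 : v = w := h.2.2.2.1
  rw [List.length_eq_one_iff] at h1
  obtain ⟨c, rfl⟩ := h1
  have h3 : Q.src c = v := h.1.1.2 c (by simp)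
  subst h2 h3
  exact ⟨c, _, rfl⟩

lemma exists_pr2 (x : GB Q R 2) : ∃ a b l, x.val = pr2 Q a b l := by
  obtain ⟨⟨⟨v, g⟩, ⟨w, l⟩⟩, h⟩ := x
  have h1 : g.length = 2 := h.2.1
  have h2 : v = w := h.2.2.2.1
  rw [List.length_eq_two] at h1
  obtain ⟨a, b, rfl⟩ := h1
  have h3 : Q.src a = v := h.1.1.2 a (by simp)
  subst h2 h3
  exact ⟨a, b, _, rfl⟩

open Classical in
lemma d0_apply (y : Coch k Q R 0) {c : Q.A} {l : List Q.A} (h : GBmem Q R 1 (pr Q c l)) :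
    dLin k Q R 0 y ⟨_, h⟩ =
      (if l.getLast? = some c then cf 0 y (pt Q (Q.src c) l.dropLast) else 0) -
      (if l.head? = some c then cf 0 y (pt Q (Q.tgt c) l.tail) else 0) := by
  rw [d_apply y h (a := c) (b := c) (g1 := []) (g2 := []) rfl rfl]
  simp

open Classical in
lemma d1_apply (y : Coch k Q R 1) {a b : Q.A} {l : List Q.A} (hab : Q.tgt a = Q.src b)
    (h : GBmem Q R 2 (pr2 Q a b l)) :
    dLin k Q R 1 y ⟨_, h⟩ =
      (if l.getLast? = some b then cf 1 y (pr Q a l.dropLast) else 0) +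
      (if l.head? = some a then cf 1 y (pr Q b l.tail) else 0) := by
  rw [d_apply y h (a := a) (b := b) (g1 := [b]) (g2 := [a]) rfl rfl]
  simp only [pow_one, neg_mul, one_mul, hab, sub_neg_eq_add]


/-! Words, powers and rotations. -/

lemma powL_one {α : Type} (l : List α) : powL l 1 = l := by simp [powL]

lemma powL_add {α : Type} (l : List α) (m n : ℕ) : powL l (m + n) = powL l m ++ powL l n := by
  induction m with
  | zero => simp [powL]
  | succ m ih => rw [Nat.succ_add]; simp [powL, ih]

lemma powL_succ' {α : Type} (l : List α) (n : ℕ) : powL l (n + 1) = powL l n ++ l := by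
  rw [powL_add, powL_one]

lemma powL_mul {α : Type} (l : List α) (m n : ℕ) : powL (powL l m) n = powL l (n * m) := by
  induction n with
  | zero => simp [powL]
  | succ n ih => rw [powL_succ', ih, ← powL_add, Nat.succ_mul]

lemma powL_length {α : Type} (l : List α) (n : ℕ) : (powL l n).length = n * l.length := by
  induction n with
  | zero => simp [powL]
  | succ n ih => simp [powL, ih]; ring

lemma powL_rot {α : Type} (m : List α) (a : α) (n : ℕ) :
    powL (m ++ [a]) n ++ m = m ++ powL (a :: m) n := by
  induction n with
  | zero => simp [powL]
  | succ n ih => rw [powL, List.append_assoc, ih]; simp [powL]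

lemma commute_pow {α : Type} : ∀ (N : ℕ) (x y : List α), x.length + y.length ≤ N →
    x ++ y = y ++ x → ∃ z i j, x = powL z i ∧ y = powL z j := by
  have key : ∀ (x y : List α), x.length ≤ y.length → x ++ y = y ++ x → ∃ t, y = x ++ t := by
    intro x y h e
    have : x <+: y := by
      apply List.prefix_of_prefix_length_le (l₃ := x ++ y)
      · exact List.prefix_append _ _
      · rw [e]; exact List.prefix_append _ _
      · exact h
    obtain ⟨t, ht⟩ := this
    exact ⟨t, ht.symm⟩
  intro N
  induction N with
  | zero =>
    intro x y h _
    have hx : x = [] := by rw [← List.length_eq_zero_iff]; omega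
    have hy : y = [] := by rw [← List.length_eq_zero_iff]; omega
    exact ⟨[], 0, 0, by simp [hx, powL], by simp [hy, powL]⟩
  | succ N ih =>
    intro x y h e
    by_cases hx : x = []
    · exact ⟨y, 0, 1, by simp [hx, powL], by simp [powL]⟩
    by_cases hy : y = []
    · exact ⟨x, 1, 0, by simp [powL], by simp [hy, powL]⟩
    have hx' : 0 < x.length := List.length_pos_of_ne_nil hx
    have hy' : 0 < y.length := List.length_pos_of_ne_nil hy
    rcases le_total x.length y.length with hl | hl
    · obtain ⟨t, rfl⟩ := key x y hl e
      rw [List.append_assoc, List.append_cancel_left_eq] at e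
      obtain ⟨z, i, j, h1, h2⟩ := ih x t (by simp at h; omega) e
      exact ⟨z, i, i + j, h1, by rw [powL_add, ← h1, ← h2]⟩
    · obtain ⟨t, rfl⟩ := key y x hl e.symm
      rw [List.append_assoc, List.append_cancel_left_eq] at e
      obtain ⟨z, i, j, h1, h2⟩ := ih t y (by simp at h; omega) e
      exact ⟨z, j + i, j, by rw [powL_add, ← h1, ← h2], h2⟩

lemma pow_eq_commute {α : Type} (x y : List α) (n m : ℕ) (hn : 1 ≤ n) (hm : 1 ≤ m)
    (h : powL x n = powL y m) : x ++ y = y ++ x := by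
  have h1 : x ++ y <+: powL x n ++ powL x n := by
    obtain ⟨n, rfl⟩ := Nat.exists_eq_add_of_le' hn
    obtain ⟨m, rfl⟩ := Nat.exists_eq_add_of_le' hm
    have : powL x (n+1) ++ powL x (n+1) = x ++ (powL x (n+1) ++ powL x n) := by
      rw [← powL_add, ← powL_add, ← powL]; congr 1
    rw [this, h]
    simp [powL]
  have h2 : y ++ x <+: powL x n ++ powL x n := by
    rw [h]
    obtain ⟨n, rfl⟩ := Nat.exists_eq_add_of_le' hn
    obtain ⟨m, rfl⟩ := Nat.exists_eq_add_of_le' hm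
    have : powL y (m+1) ++ powL y (m+1) = y ++ (powL y (m+1) ++ powL y m) := by
      rw [← powL_add, ← powL_add, ← powL]; congr 1
    rw [this, ← h]
    simp [powL]
  have h3 := List.prefix_of_prefix_length_le h1 h2 (by simp; omega)
  exact h3.eq_of_length (by simp; omega)

lemma cc_iff (p : PathDat Q) : Cocomplete Q R p ↔
    p.2 ≠ [] ∧ (∀ a ∈ p.2.head?, Q.src a = p.1) ∧ (p.2 ++ p.2).IsChain (NR Q R) := by
  obtain ⟨v, l⟩ := p
  unfold Cocomplete IsCycle powP
  rw [inB_iff]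
  rcases List.eq_nil_or_concat l with rfl | ⟨l', d, rfl⟩
  · simp
  · simp only [powL, List.concat_eq_append, List.append_nil, ne_eq, psrc, ptgt]
    constructor
    · rintro ⟨⟨h1, h2, h3⟩, h4, h5⟩
      exact ⟨h2, h1.2, h4⟩
    · rintro ⟨h2, h1, h4⟩
      have h5 := List.isChain_append.1 h4
      have h6 := (inB_iff (R := R) v (l' ++ [d])).2 ⟨h5.1, h1⟩
      refine ⟨⟨h6.1, h2, ?_⟩, h4, ?_⟩
      · obtain ⟨e, he⟩ : ∃ e, (l' ++ [d]).head? = some e := by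
          rw [← Option.isSome_iff_exists]; simp
        have h7 := h5.2.2 d (by simp) e (by simp [he])
        rw [List.getLast?_append]
        simp
        rw [h7.1, h1 e (by simp [he])]
      · intro a ha
        apply h1 a
        simpa using ha

lemma rotP_append (v : Q.V) (m : List Q.A) (a : Q.A) :
    rotP Q (v, m ++ [a]) = (Q.src a, a :: m) := by
  simp [rotP]

lemma rotP_pow (p : PathDat Q) (n : ℕ) (hp : p.2 ≠ []) (hn : 1 ≤ n) :
    rotP Q (powP Q p n) = powP Q (rotP Q p) n := by
  obtain ⟨v, l⟩ := p
  obtain ⟨n, rfl⟩ := Nat.exists_eq_add_of_le' hn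
  rcases List.eq_nil_or_concat l with rfl | ⟨m, a, rfl⟩
  · simp at hp
  · rw [List.concat_eq_append, rotP_append]
    unfold powP
    simp only
    rw [powL_succ', ← List.append_assoc, rotP_append, powL_rot]
    simp [powL]

lemma rotP_ne (p : PathDat Q) (hp : p.2 ≠ []) : (rotP Q p).2 ≠ [] := by
  obtain ⟨v, l⟩ := p
  rcases List.eq_nil_or_concat l with rfl | ⟨m, a, rfl⟩
  · simp at hp
  · rw [List.concat_eq_append, rotP_append]; simp

lemma rotI_succ (i : ℕ) (p : PathDat Q) : rotI Q (i+1) p = rotI Q i (rotP Q p) := rfl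

lemma rotI_succ' (i : ℕ) (p : PathDat Q) : rotI Q (i+1) p = rotP Q (rotI Q i p) :=
  Function.iterate_succ_apply' _ _ _

lemma rotI_pow (i : ℕ) (p : PathDat Q) (n : ℕ) (hp : p.2 ≠ []) (hn : 1 ≤ n) :
    rotI Q i (powP Q p n) = powP Q (rotI Q i p) n := by
  induction i generalizing p with
  | zero => rfl
  | succ i ih => rw [rotI_succ, rotI_succ, rotP_pow p n hp hn, ih _ (rotP_ne p hp)]

lemma cc_rotP (p : PathDat Q) (hp : Cocomplete Q R p) : Cocomplete Q R (rotP Q p) := by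
  rw [cc_iff] at hp ⊢
  obtain ⟨v, l⟩ := p
  rcases List.eq_nil_or_concat l with rfl | ⟨m, a, rfl⟩
  · simp at hp
  · rw [List.concat_eq_append, rotP_append]
    rw [List.concat_eq_append] at hp
    refine ⟨by simp, by simp, ?_⟩
    have h := hp.2.2
    simp only at h ⊢
    have h1 : (m ++ [a] ++ m).IsChain (NR Q R) :=
      h.prefix ⟨[a], by simp⟩
    have h2 : ([a] ++ m ++ [a]).IsChain (NR Q R) :=
      h.suffix ⟨m, by simp⟩
    have h3 : ([a] ++ m).IsChain (NR Q R) := h1.suffix ⟨m, by simp⟩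
    have : a :: m ++ a :: m = ([a] ++ m) ++ ([a] ++ m) := by simp
    rw [this]
    rw [List.isChain_append] at h2 ⊢
    refine ⟨h3, h3, ?_⟩
    intro x hx y hy
    exact h2.2.2 x hx y (by simpa using hy)

lemma cc_rotI (i : ℕ) (p : PathDat Q) (hp : Cocomplete Q R p) : Cocomplete Q R (rotI Q i p) := by
  induction i generalizing p with
  | zero => exact hp
  | succ i ih => exact ih _ (cc_rotP p hp)

lemma rotI_append (l2 : List Q.A) : ∀ (l1 : List Q.A) (v : Q.V),
    (rotI Q l2.length (v, l1 ++ l2)).2 = l2 ++ l1 := by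
  induction l2 using List.reverseRecOn with
  | nil => intro l1 v; simp [rotI]
  | append_singleton l a ih =>
    intro l1 v
    rw [List.length_append, List.length_singleton, rotI_succ, ← List.append_assoc, rotP_append]
    have := ih (a :: l1) (Q.src a)
    simp only [List.cons_append] at this
    rw [this]; simp

lemma cc_ext {p q : PathDat Q} (hp : Cocomplete Q R p) (hq : Cocomplete Q R q) (h : p.2 = q.2) :
    p = q := by
  rw [cc_iff] at hp hq
  obtain ⟨v, l⟩ := p
  obtain ⟨w, l'⟩ := q
  simp only at h
  subst h
  cases l with
  | nil => simp at hp
  | cons a l => 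
    have h1 := hp.2.1 a (by simp)
    have h2 := hq.2.1 a (by simp)
    simp only at h1 h2
    rw [← h1, ← h2]

lemma rotI_length (p : PathDat Q) (hp : Cocomplete Q R p) : rotI Q p.2.length p = p := by
  apply cc_ext (cc_rotI _ p hp) hp
  have := rotI_append p.2 [] p.1
  simpa using this

lemma rotI_add (i j : ℕ) (p : PathDat Q) : rotI Q (i + j) p = rotI Q i (rotI Q j p) :=
  Function.iterate_add_apply _ _ _ _

lemma rotI_mul_length (p : PathDat Q) (hp : Cocomplete Q R p) (n : ℕ) :
    rotI Q (n * p.2.length) p = p := by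
  induction n with
  | zero => simp [rotI]
  | succ n ih => rw [Nat.succ_mul, rotI_add, rotI_length p hp, ih]

lemma rotI_back (p : PathDat Q) (hp : Cocomplete Q R p) (i : ℕ) :
    ∃ j, rotI Q j (rotI Q i p) = p := by
  have hl : 0 < p.2.length := List.length_pos_of_ne_nil ((cc_iff p).1 hp).1
  refine ⟨i * p.2.length - i, ?_⟩
  rw [← rotI_add, Nat.sub_add_cancel (Nat.le_mul_of_pos_right i hl), rotI_mul_length p hp]

lemma cc_of_pow (q : PathDat Q) (n : ℕ) (hn : 2 ≤ n) (hq : q.2 ≠ [])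
    (h : Cocomplete Q R (powP Q q n)) : Cocomplete Q R q := by
  rw [cc_iff] at h ⊢
  obtain ⟨n, rfl⟩ := Nat.exists_eq_add_of_le' hn
  refine ⟨hq, ?_, ?_⟩
  · intro a ha
    apply h.2.1 a
    simp only [powP, powL, List.head?_append]
    rw [Option.mem_def] at ha
    simp [ha]
  · refine h.2.2.prefix ⟨powL q.2 n ++ powL q.2 (n + 2), ?_⟩
    simp [powP, powL]

lemma cc_pow (q : PathDat Q) (n : ℕ) (hn : 1 ≤ n)
    (h : Cocomplete Q R q) : Cocomplete Q R (powP Q q n) := by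
  rw [cc_iff] at h ⊢
  obtain ⟨h1, h2, h3⟩ := h
  have key : ∀ m, (powL q.2 (m+1)).IsChain (NR Q R) ∧ (powL q.2 (m+1)).getLast? = q.2.getLast? ∧
      (powL q.2 (m+1)).head? = q.2.head? := by
    intro m
    obtain ⟨e, he⟩ : ∃ e, q.2.head? = some e := by
      rw [← Option.isSome_iff_exists]; simpa using h1
    obtain ⟨f, hf⟩ : ∃ e, q.2.getLast? = some e := by
      rw [← Option.isSome_iff_exists]; simpa using h1
    rw [List.isChain_append] at h3
    induction m with
    | zero => simp [powL, h3.1]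
    | succ m ih =>
      rw [powL, List.isChain_append, List.getLast?_append, List.head?_append, ih.2.1, ih.2.2]
      exact ⟨⟨h3.1, ih.1, h3.2.2⟩, by simp [hf], by simp [he]⟩
  obtain ⟨n, rfl⟩ := Nat.exists_eq_add_of_le' hn
  refine ⟨?_, ?_, ?_⟩
  · intro h
    have := (key n).2.2
    simp only [powP] at h
    rw [h] at this
    exact h1 (List.head?_eq_none_iff.1 this.symm)
  · simpa only [powP, (key n).2.2] using h2
  · simp only [powP]
    rw [← powL_add]
    exact (key (n + 1 + n)).1

lemma exists_root : ∀ (N : ℕ) (p : PathDat Q), p.2.length ≤ N → Cocomplete Q R p →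
    ∃ q n, 1 ≤ n ∧ IsPrimitive Q q ∧ Cocomplete Q R q ∧ p = powP Q q n := by
  intro N
  induction N with
  | zero =>
    intro p hp h
    exact absurd (List.length_eq_zero_iff.1 (Nat.le_zero.1 hp)) ((cc_iff p).1 h).1
  | succ N ih =>
    intro p hp h
    by_cases hprim : IsPrimitive Q p
    · exact ⟨p, 1, le_rfl, hprim, h, by simp [powP, powL_one]⟩
    · have : ∃ (q : PathDat Q) (n : ℕ), IsCycle Q q ∧ 2 ≤ n ∧ p = powP Q q n := by
        by_contra hcon
        push Not at hcon
        exact hprim ⟨h.1, fun q n h1 h2 => hcon q n h1 h2⟩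
      obtain ⟨q, n, hq, hn, rfl⟩ := this
      have hcq := cc_of_pow q n hn hq.2.1 h
      have hl : 0 < q.2.length := List.length_pos_of_ne_nil hq.2.1
      obtain ⟨r, m, hm, h1, h2, rfl⟩ := ih q (by
        simp only [powP, powL_length] at hp
        nlinarith) hcq
      refine ⟨r, n * m, by nlinarith, h1, h2, ?_⟩
      simp [powP, powL_mul]

lemma prim_rotI (p : PathDat Q) (hp : Cocomplete Q R p) (h : IsPrimitive Q p) (i : ℕ) :
    IsPrimitive Q (rotI Q i p) := by
  have hc := cc_rotI i p hp
  refine ⟨hc.1, ?_⟩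
  intro q n hq hn he
  obtain ⟨j, hj⟩ := rotI_back p hp i
  have hcq := cc_of_pow (R := R) q n hn hq.2.1 (he ▸ hc)
  rw [he, rotI_pow _ _ _ hq.2.1 (by omega)] at hj
  exact h.2 _ n (cc_rotI (R := R) j q hcq).1 hn hj.symm

lemma prim_unique (p q : PathDat Q) (hp : Cocomplete Q R p) (hq : Cocomplete Q R q)
    (h1 : IsPrimitive Q p) (h2 : IsPrimitive Q q) (n m : ℕ) (hn : 1 ≤ n) (hm : 1 ≤ m)
    (h : powP Q p n = powP Q q m) : p = q := by
  have aux : ∀ (p : PathDat Q) z i, Cocomplete Q R p → IsPrimitive Q p → p.2 = powL z i →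
      p.2 = z := by
    intro p z i hp h1 hi
    have hz : z ≠ [] := by
      rintro rfl
      apply ((cc_iff p).1 hp).1
      rw [hi, ← List.length_eq_zero_iff, powL_length]; simp
    rcases lt_trichotomy i 1 with h0 | h0 | h0
    · exfalso
      apply ((cc_iff p).1 hp).1
      obtain rfl : i = 0 := by omega
      exact hi
    · subst h0; rw [hi, powL_one]
    · exfalso
      have hpe : p = powP Q (p.1, z) i := by
        ext1
        · rfl
        · exact hi
      have := cc_of_pow (R := R) (p.1, z) i h0 hz (hpe ▸ hp)
      exact h1.2 _ i this.1 h0 hpe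
  have h' : powL p.2 n = powL q.2 m := congrArg Prod.snd h
  obtain ⟨z, i, j, hi, hj⟩ := commute_pow _ p.2 q.2 le_rfl (pow_eq_commute _ _ n m hn hm h')
  exact cc_ext hp hq ((aux p z i hp h1 hi).trans (aux q z j hq h2 hj).symm)

lemma S_cc {S : Set (PathDat Q)} (hS : IsCrep Q S (Cocomplete Q R)) {δ} (h : δ ∈ S) :
    Cocomplete Q R δ := by
  obtain ⟨P, hP, rfl⟩ := hS
  obtain ⟨p, hp, n, hn, rfl⟩ := h
  exact cc_pow p n hn (hP.1 p hp).2

lemma S_ex {S : Set (PathDat Q)} (hS : IsCrep Q S (Cocomplete Q R)) {δ}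
    (h : Cocomplete Q R δ) : ∃ i, rotI Q i δ ∈ S := by
  obtain ⟨P, hP, rfl⟩ := hS
  obtain ⟨q, n, hn, h1, h2, rfl⟩ := exists_root _ δ le_rfl h
  obtain ⟨p, ⟨hp, i, hi⟩, -⟩ := hP.2 q ⟨h1, h2⟩
  refine ⟨i, p, hp, n, hn, ?_⟩
  rw [rotI_pow _ _ _ ((cc_iff q).1 h2).1 hn, hi]

lemma S_uniq {S : Set (PathDat Q)} (hS : IsCrep Q S (Cocomplete Q R)) {δ} (h : δ ∈ S)
    (i : ℕ) (h' : rotI Q i δ ∈ S) : rotI Q i δ = δ := by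
  obtain ⟨P, hP, rfl⟩ := hS
  obtain ⟨p, hp, n, hn, rfl⟩ := h
  obtain ⟨q, hq, m, hm, he⟩ := h'
  have hpp := hP.1 p hp
  have hqq := hP.1 q hq
  rw [he]
  have hne := ((cc_iff p).1 hpp.2).1
  rw [rotI_pow _ _ _ hne hn] at he
  have e1 := prim_unique (R := R) _ q (cc_rotI i p hpp.2) hqq.2
    (prim_rotI p hpp.2 hpp.1 i) hqq.1 n m hn hm he
  have e2 : p = q := (hP.2 p hpp).unique ⟨hp, 0, rfl⟩ ⟨hq, i, e1⟩
  subst e2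
  have hl := congrArg (fun x => x.2.length) he
  simp only [e1, powP, powL_length] at hl
  have : n = m := Nat.eq_of_mul_eq_mul_right (List.length_pos_of_ne_nil hne) hl
  rw [this]


/-! The differential squares to zero in degree zero. -/

lemma chain_last_not {l : List Q.A} {a b : Q.A} (h : (l ++ [b]).IsChain (NR Q R))
    (hl : l.getLast? = some a) : NR Q R a b :=
  (List.isChain_append.1 h).2.2 a hl b (by simp)

lemma chain_head_not {l : List Q.A} {a b : Q.A} (h : (a :: l).IsChain (NR Q R))
    (hl : l.head? = some b) : NR Q R a b :=
  (List.isChain_cons.1 h).1 b hl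

lemma eq_of_last {l : List Q.A} {b : Q.A} (h : l.getLast? = some b) :
    l = l.dropLast ++ [b] := by
  rcases List.eq_nil_or_concat l with rfl | ⟨l', d, rfl⟩
  · simp at h
  · simpa using h

lemma eq_of_head {l : List Q.A} {b : Q.A} (h : l.head? = some b) :
    l = b :: l.tail := by
  cases l with
  | nil => simp at h
  | cons => simpa using h

lemma mem2_left (hg : IsGentle Q R) {a b : Q.A} {l : List Q.A}
    (h : GBmem Q R 2 (pr2 Q a b (l ++ [b]))) : GBmem Q R 1 (pr Q a l) := by
  rw [mem2 hg] at h
  have hab : Q.tgt a = Q.src b := hg.relComposable _ h.1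
  rw [mem1]
  obtain ⟨h1, h2, h3, -, -⟩ := h
  refine ⟨h2.prefix ⟨[b], rfl⟩, ?_, ?_, ?_⟩
  · intro c hc; apply h3 c; cases l <;> simp_all
  · intro c hc; rw [hab]; exact (chain_last_not h2 hc).1
  · rintro rfl; rw [hab]; exact (h3 b (by simp)).symm

lemma mem2_right (hg : IsGentle Q R) {a b : Q.A} {l : List Q.A}
    (h : GBmem Q R 2 (pr2 Q a b (a :: l))) : GBmem Q R 1 (pr Q b l) := by
  rw [mem2 hg] at h
  have hab : Q.tgt a = Q.src b := hg.relComposable _ h.1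
  rw [mem1]
  obtain ⟨h1, h2, -, h3, -⟩ := h
  refine ⟨h2.suffix ⟨[a], rfl⟩, ?_, ?_, ?_⟩
  · intro c hc; rw [← hab]; exact (chain_head_not h2 hc).1.symm
  · intro c hc; apply h3 c
    rw [Option.mem_def] at hc
    rw [List.getLast?_cons, hc]; simp
  · rintro rfl; rw [← hab]; exact (h3 a (by simp))

lemma dd0 (hg : IsGentle Q R) (y : Coch k Q R 0) : dLin k Q R 1 (dLin k Q R 0 y) = 0 := by
  classical
  ext Y
  obtain ⟨a, b, l, he⟩ := exists_pr2 Y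
  obtain ⟨Y, hY⟩ := Y
  simp only at he
  subst he
  have hm := (mem2 hg a b l).1 hY
  have hab : Q.tgt a = Q.src b := hg.relComposable _ hm.1
  rw [d1_apply _ hab hY]
  simp only [Finsupp.coe_zero, Pi.zero_apply]
  have t1 : (if l.getLast? = some b then cf 1 (dLin k Q R 0 y) (pr Q a l.dropLast) else 0) =
      - if l.getLast? = some b ∧ l.dropLast.head? = some a then
        cf 0 y (pt Q (Q.tgt a) l.dropLast.tail) else 0 := by
    by_cases h1 : l.getLast? = some b
    · have hl := eq_of_last h1
      have hY' := hY
      rw [hl] at hY'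
      rw [if_pos h1, cf_mem _ (mem2_left hg hY'), d0_apply, if_neg]
      · simp [h1]
      · intro h2
        exact (chain_last_not (hl ▸ hm.2.1) h2).2 hm.1
    · simp [h1]
  have t2 : (if l.head? = some a then cf 1 (dLin k Q R 0 y) (pr Q b l.tail) else 0) =
      if l.head? = some a ∧ l.tail.getLast? = some b then
        cf 0 y (pt Q (Q.src b) l.tail.dropLast) else 0 := by
    by_cases h1 : l.head? = some a
    · have hl := eq_of_head h1
      have hY' := hY
      rw [hl] at hY'
      rw [if_pos h1, cf_mem _ (mem2_right hg hY'), d0_apply, if_neg (c := l.tail.head? = some b)]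
      · simp [h1]
      · intro h2
        exact (chain_head_not (hl ▸ hm.2.1) h2).2 hm.1
    · simp [h1]
  rw [t1, t2, hab, List.tail_dropLast]
  have : (l.getLast? = some b ∧ l.dropLast.head? = some a) ↔
      (l.head? = some a ∧ l.tail.getLast? = some b) := by
    rcases l with _ | ⟨c, _ | ⟨d, l⟩⟩ <;> simp [and_comm]
  simp only [this]
  simp

/-! The generating set. -/

/-- The set of generators. -/
def GenS (k : Type) [Field k] (Q : Quiv) (R : Set (Q.A × Q.A)) (T : Set Q.A)
    (S : Set (PathDat Q)) : Set (Coch k Q R 1) :=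
  ({x | ∃ c : Q.A, c ∉ T ∧ x = bv k Q R 1 ((Q.src c, [c]), (Q.src c, [c]))} ∪
       {x | ∃ (c : Q.A) (α : PathDat Q), GMax Q R (Q.src c, [c]) ∧
            GBmem Q R 1 ((Q.src c, [c]), α) ∧
            α.2.head? ≠ some c ∧ α.2.getLast? ≠ some c ∧
            x = bv k Q R 1 ((Q.src c, [c]), α)} ∪
       {x | ∃ δ ∈ S, ∃ c : Q.A, δ.2.head? = some c ∧
            x = bv k Q R 1 ((Q.src c, [c]), (δ.1, δ.2 ++ [c]))} ∪
       {x | ringChar k = 2 ∧ ∃ b : Q.A, Q.src b = Q.tgt b ∧ (b, b) ∈ R ∧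
            x = bv k Q R 1 ((Q.src b, [b]), (Q.src b, []))})

/-- Combinatorial description of the generators. -/
def GenP (k : Type) [Field k] (Q : Quiv) (R : Set (Q.A × Q.A)) (T : Set Q.A)
    (S : Set (PathDat Q)) (c : Q.A) (l : List Q.A) : Prop :=
  (c ∉ T ∧ l = [c]) ∨
  (GMax Q R (Q.src c, [c]) ∧ l.head? ≠ some c ∧ l.getLast? ≠ some c) ∨
  (∃ δ ∈ S, δ.2.head? = some c ∧ l = δ.2 ++ [c]) ∨
  (ringChar k = 2 ∧ Q.src c = Q.tgt c ∧ (c, c) ∈ R ∧ l = [])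

lemma gbmem_cc {δ : PathDat Q} (h : Cocomplete Q R δ) {c : Q.A} (hc : δ.2.head? = some c) :
    Q.src c = δ.1 ∧ GBmem Q R 1 (pr Q c (δ.2 ++ [c])) := by
  rw [cc_iff] at h
  obtain ⟨h1, h2, h3⟩ := h
  refine ⟨h2 c hc, ?_⟩
  rw [mem1]
  refine ⟨?_, ?_, by simp, by simp⟩
  · refine h3.prefix ⟨δ.2.tail, ?_⟩
    conv_rhs => rw [eq_of_head hc]
    conv_lhs => rw [eq_of_head hc]
    simp
  · intro a ha
    simp [hc] at ha
    rw [ha]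

lemma gbmem_self (c : Q.A) : GBmem Q R 1 (pr Q c [c]) := by
  rw [mem1]; simp

lemma genS_iff {T : Set Q.A} {S : Set (PathDat Q)} (hS : IsCrep Q S (Cocomplete Q R))
    (x : Coch k Q R 1) : x ∈ GenS k Q R T S ↔
      ∃ c l, ∃ h : GBmem Q R 1 (pr Q c l), GenP k Q R T S c l ∧ x = Finsupp.single ⟨_, h⟩ 1 := by
  constructor
  · rintro (((⟨c, hc, rfl⟩ | ⟨c, ⟨v, l⟩, h1, h2, h3, h4, rfl⟩) | ⟨δ, hδ, c, hc, rfl⟩) |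
      ⟨h2, b, hb, hbR, rfl⟩)
    · exact ⟨c, [c], gbmem_self c, Or.inl ⟨hc, rfl⟩, bv_mem _⟩
    · obtain rfl : Q.src c = v := h2.2.2.2.1
      exact ⟨c, l, h2, Or.inr (Or.inl ⟨h1, h3, h4⟩), bv_mem _⟩
    · obtain ⟨h1, h2⟩ := gbmem_cc (S_cc hS hδ) hc
      refine ⟨c, δ.2 ++ [c], h2, Or.inr (Or.inr (Or.inl ⟨δ, hδ, hc, rfl⟩)), ?_⟩
      rw [← h1]
      exact bv_mem _
    · refine ⟨b, [], ?_, Or.inr (Or.inr (Or.inr ⟨h2, hb, hbR, rfl⟩)), bv_mem _⟩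
      rw [mem1]; simp [hb]
  · rintro ⟨c, l, h, hP, rfl⟩
    rw [← bv_mem h]
    rcases hP with ⟨h1, rfl⟩ | ⟨h1, h2, h3⟩ | ⟨δ, hδ, hc, rfl⟩ | ⟨h1, h2, h3, rfl⟩
    · exact Or.inl (Or.inl (Or.inl ⟨c, h1, rfl⟩))
    · exact Or.inl (Or.inl (Or.inr ⟨c, _, h1, h, h2, h3, rfl⟩))
    · refine Or.inl (Or.inr ⟨δ, hδ, c, hc, ?_⟩)
      rw [← (gbmem_cc (S_cc hS hδ) hc).1]
    · exact Or.inr ⟨h1, c, h2, h3, rfl⟩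

lemma genS_coeff {T : Set Q.A} {S : Set (PathDat Q)} (hS : IsCrep Q S (Cocomplete Q R))
    {x : Coch k Q R 1} (hx : x ∈ Submodule.span k (GenS k Q R T S)) {c l}
    (h : GBmem Q R 1 (pr Q c l)) (hne : x ⟨_, h⟩ ≠ 0) : GenP k Q R T S c l := by
  classical
  by_contra hP
  apply hne
  induction hx using Submodule.span_induction with
  | mem x hx =>
    rw [genS_iff hS] at hx
    obtain ⟨c', l', h', hP', rfl⟩ := hx
    rw [Finsupp.single_apply, if_neg]
    intro he
    simp only [Subtype.mk.injEq, Prod.mk.injEq] at he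
    obtain ⟨⟨-, e1⟩, -, e2⟩ := he
    simp only [List.cons.injEq, and_true] at e1
    subst e1 e2
    exact hP hP'
  | zero => rfl
  | add x y _ _ hx hy =>
    rw [Finsupp.add_apply]
    by_cases h1 : x ⟨_, h⟩ = 0
    · by_cases h2 : y ⟨_, h⟩ = 0
      · rw [h1, h2, add_zero]
      · exact absurd (hy h2) h2
    · exact absurd (hx h1) h1
  | smul r x _ hx =>
    by_cases h1 : x ⟨_, h⟩ = 0
    · simp [h1]
    · exact absurd (hx h1) h1

lemma gmax_iff (hg : IsGentle Q R) (c : Q.A) : GMax Q R (Q.src c, [c]) ↔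
    (∀ b, (c, b) ∉ R) ∧ (∀ a, (a, c) ∉ R) := by
  have hI : ∀ a b, (a, b) ∈ R → InG Q R (Q.src a, [a, b]) := by
    intro a b hab
    have := hg.relComposable _ hab
    simp only at this
    simp [InG, Ok, List.Chain', this, hab]
  constructor
  · intro h
    refine ⟨fun b hb => ?_, fun a ha => ?_⟩
    · have := h.2 _ (hI _ _ hb) ⟨[], [b], rfl⟩
      simp at this
    · have := h.2 _ (hI _ _ ha) ⟨[a], [], rfl⟩
      simp at this
  · rintro ⟨h1, h2⟩
    refine ⟨by simp [InG, Ok, List.Chain'], ?_⟩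
    rintro ⟨v, g⟩ hq ⟨s, t, e⟩
    simp only at e ⊢
    have hch : g.IsChain (fun a b => (a, b) ∈ R) := hq.2
    rw [← e] at hch ⊢
    have ht : t = [] := by
      cases t with
      | nil => rfl
      | cons b t =>
        exfalso
        refine h1 b (((List.isChain_append.1 hch).2.2) c (by simp) b (by simp))
    have hs : s = [] := by
      rcases List.eq_nil_or_concat s with rfl | ⟨s', a, rfl⟩
      · rfl
      · exfalso
        rw [List.append_assoc] at hch
        refine h2 a (((List.isChain_append.1 hch).2.2) a (by simp) c (by simp))
    simp [hs, ht]

lemma gen_cocycle (hg : IsGentle Q R) {T : Set Q.A} {S : Set (PathDat Q)}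
    {c l} (h : GBmem Q R 1 (pr Q c l)) (hP : GenP k Q R T S c l) :
    dLin k Q R 1 (Finsupp.single ⟨_, h⟩ 1) = 0 := by
  classical
  ext Y
  obtain ⟨a, b, l', he⟩ := exists_pr2 Y
  obtain ⟨Y, hY⟩ := Y
  simp only at he
  subst he
  have hm := (mem2 hg a b l').1 hY
  have hab : Q.tgt a = Q.src b := hg.relComposable _ hm.1
  rw [d1_apply _ hab hY]
  simp only [cf_single, Finsupp.coe_zero, Pi.zero_apply, Prod.mk.injEq, List.cons.injEq, and_true,
    ← ite_and]
  have key : (l.head? = some c ∧ l.getLast? = some c) ∨ GMax Q R (Q.src c, [c]) →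
      (if l'.getLast? = some b ∧ (Q.src c = Q.src a ∧ c = a) ∧ Q.src c = Q.src a ∧ l = l'.dropLast
        then (1:k) else 0) +
      (if l'.head? = some a ∧ (Q.src c = Q.src b ∧ c = b) ∧ Q.src c = Q.src b ∧ l = l'.tail
        then (1:k) else 0) = 0 := by
    intro hor
    rw [if_neg, if_neg, add_zero]
    · rintro ⟨h1, ⟨-, rfl⟩, -, rfl⟩
      rcases hor with hor | hor
      · exact (chain_head_not (eq_of_head h1 ▸ hm.2.1) hor.1).2 hm.1
      · exact ((gmax_iff hg c).1 hor).2 _ hm.1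
    · rintro ⟨h1, ⟨-, rfl⟩, -, rfl⟩
      rcases hor with hor | hor
      · exact (chain_last_not (eq_of_last h1 ▸ hm.2.1) hor.2).2 hm.1
      · exact ((gmax_iff hg c).1 hor).1 _ hm.1
  rcases hP with ⟨h1, rfl⟩ | ⟨h1, h2, h3⟩ | ⟨δ, hδ, hc, rfl⟩ | ⟨h1, h2, h3, rfl⟩
  · exact key (Or.inl (by simp))
  · exact key (Or.inr h1)
  · exact key (Or.inl (by simp [hc]))
  · have h20 : (1 : k) + 1 = 0 := by
      have := ringChar.Nat.cast_ringChar (R := k)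
      rw [h1] at this
      rw [one_add_one_eq_two]
      exact_mod_cast this
    have e : (l'.getLast? = some b ∧ (Q.src c = Q.src a ∧ c = a) ∧ Q.src c = Q.src a ∧
        [] = l'.dropLast) ↔ (l'.head? = some a ∧ (Q.src c = Q.src b ∧ c = b) ∧
        Q.src c = Q.src b ∧ [] = l'.tail) := by
      constructor
      · rintro ⟨e1, ⟨-, rfl⟩, -, e2⟩
        obtain rfl : c = b := hg.uniqRelAfter c ⟨h2.symm, h3⟩ ⟨hab, hm.1⟩
        have := eq_of_last e1
        rw [← e2] at this
        subst this
        simp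
      · rintro ⟨e1, ⟨-, rfl⟩, -, e2⟩
        obtain rfl : c = a := hg.uniqRelBefore c ⟨h2.symm, h3⟩ ⟨hab, hm.1⟩
        have := eq_of_head e1
        rw [← e2] at this
        subst this
        simp
    simp only [e]
    split_ifs
    · exact h20
    · simp


/-! The spanning tree. -/

lemma tree_const {T : Set Q.A} (hT : IsSpanningTree Q T) (y : Q.V → k)
    (h : ∀ t ∈ T, y (Q.src t) = y (Q.tgt t)) (v w : Q.V) : y v = y w := by
  have := hT.1 v w
  induction this with
  | refl => rfl
  | tail _ h1 ih =>
    obtain ⟨a, ha, ⟨rfl, rfl⟩ | ⟨rfl, rfl⟩⟩ := h1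
    · rw [ih, h a ha]
    · rw [ih, h a ha]

lemma tree_solve {T : Set Q.A} (hT : IsSpanningTree Q T) (f : Q.A → k) :
    ∃ y : Q.V → k, ∀ t ∈ T, y (Q.src t) - y (Q.tgt t) = f t := by
  classical
  let L : (Q.V → k) →ₗ[k] (T → k) :=
    { toFun := fun y t => y (Q.src t) - y (Q.tgt t)
      map_add' := by intro x y; ext t; simp; ring
      map_smul' := by intro r x; ext t; simp; ring }
  have hker : Module.finrank k (LinearMap.ker L) ≤ 1 := by
    apply finrank_le_one_iff.2
    refine ⟨⟨fun _ => 1, ?_⟩, ?_⟩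
    · rw [LinearMap.mem_ker]; ext t; simp [L]
    · rintro ⟨y, hy⟩
      rw [LinearMap.mem_ker] at hy
      have hc := tree_const hT y (fun t ht => by
        have := congrFun hy ⟨t, ht⟩
        simp only [L, LinearMap.coe_mk, AddHom.coe_mk, Pi.zero_apply] at this
        exact sub_eq_zero.1 this)
      have hV : Nonempty Q.V := by
        rw [← Fintype.card_pos_iff, ← hT.2]; omega
      obtain ⟨v0⟩ := hV
      refine ⟨y v0, ?_⟩
      ext v
      simp [hc v v0]
  have hrn := LinearMap.finrank_range_add_finrank_ker L
  rw [Module.finrank_fintype_fun_eq_card, ← hT.2] at hrn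
  have hTc : Module.finrank k (T → k) = T.ncard := by
    rw [Module.finrank_fintype_fun_eq_card, ← Nat.card_eq_fintype_card]
    rfl
  have hsurj : LinearMap.range L = ⊤ := by
    apply Submodule.eq_top_of_finrank_eq
    apply le_antisymm (Submodule.finrank_le _)
    omega
  obtain ⟨y, hy⟩ := LinearMap.range_eq_top.1 hsurj (fun t => f t)
  exact ⟨y, fun t ht => congrFun hy ⟨t, ht⟩⟩

lemma supp_mem {m : ℕ} (N : Submodule k (Coch k Q R m)) (w : Coch k Q R m)
    (h : ∀ X, w X ≠ 0 → Finsupp.single X (1 : k) ∈ N) : w ∈ N := by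
  rw [← Finsupp.sum_single w]
  refine Submodule.sum_mem _ fun X hX => ?_
  have := N.smul_mem (w X) (h X (Finsupp.mem_support_iff.1 hX))
  simpa using this

/-! Coboundaries of single closed paths. -/

lemma mem0_of_left {c : Q.A} {l : List Q.A} (h : GBmem Q R 1 (pr Q c (l ++ [c]))) :
    GBmem Q R 0 (pt Q (Q.src c) l) := by
  rw [mem1] at h
  rw [mem0]
  refine ⟨h.1.prefix ⟨[c], rfl⟩, ?_, fun b hb => (chain_last_not h.1 hb).1⟩
  intro a ha
  apply h.2.1 a
  cases l <;> simp_all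

lemma mem0_of_right {c : Q.A} {l : List Q.A} (h : GBmem Q R 1 (pr Q c (c :: l))) :
    GBmem Q R 0 (pt Q (Q.tgt c) l) := by
  rw [mem1] at h
  rw [mem0]
  refine ⟨h.1.suffix ⟨[c], rfl⟩, fun b hb => (chain_head_not h.1 hb).1.symm, ?_⟩
  intro a ha
  apply h.2.2.1 a
  rw [Option.mem_def] at ha
  rw [List.getLast?_cons, ha]; simp

open Classical in
lemma d0_pt {v : Q.V} {l : List Q.A} (h : GBmem Q R 0 (pt Q v l)) :
    dLin k Q R 0 (Finsupp.single ⟨_, h⟩ 1) =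
      (∑ b : Q.A, if Q.src b = v then bv k Q R 1 (pr Q b (l ++ [b])) else 0) -
      ∑ a : Q.A, if Q.tgt a = v then bv k Q R 1 (pr Q a (a :: l)) else 0 := by
  rw [dLin_single, dB_eq, one_smul, pow_zero, one_smul]
  congr 1
  refine Finset.sum_congr rfl fun b _ => ?_
  split_ifs with hb
  · subst hb; rfl
  · apply bv_not
    intro hm
    exact hb (hm.1.1.2 b (by simp [extL]))

open Classical in
lemma sumL (hg : IsGentle Q R) {l : List Q.A} {b0 : Q.A} (hl : l ≠ [])
    (h : GBmem Q R 1 (pr Q b0 (l ++ [b0]))) :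
    (∑ b : Q.A, if Q.src b = Q.src b0 then bv k Q R 1 (pr Q b (l ++ [b])) else 0) =
      bv k Q R 1 (pr Q b0 (l ++ [b0])) := by
  rw [Finset.sum_eq_single b0]
  · rw [if_pos rfl]
  · intro b _ hb
    split_ifs
    · apply bv_not
      intro hm
      apply hb
      rw [mem1] at hm h
      obtain ⟨d, hd⟩ : ∃ e, l.getLast? = some e := by
        rw [← Option.isSome_iff_exists]; simpa using hl
      exact hg.uniqNotRelAfter d (chain_last_not hm.1 hd) (chain_last_not h.1 hd)
    · rfl
  · simp

open Classical in
lemma sumR (hg : IsGentle Q R) {l : List Q.A} {a0 : Q.A} (hl : l ≠ [])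
    (h : GBmem Q R 1 (pr Q a0 (a0 :: l))) :
    (∑ a : Q.A, if Q.tgt a = Q.tgt a0 then bv k Q R 1 (pr Q a (a :: l)) else 0) =
      bv k Q R 1 (pr Q a0 (a0 :: l)) := by
  rw [Finset.sum_eq_single a0]
  · rw [if_pos rfl]
  · intro b _ hb
    split_ifs
    · apply bv_not
      intro hm
      apply hb
      rw [mem1] at hm h
      obtain ⟨d, hd⟩ : ∃ e, l.head? = some e := by
        rw [← Option.isSome_iff_exists]; simpa using hl
      exact hg.uniqNotRelBefore d (chain_head_not hm.1 hd) (chain_head_not h.1 hd)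
    · rfl
  · simp

lemma cc_of_mem {c : Q.A} {m : List Q.A} (h : GBmem Q R 1 (pr Q c (c :: m ++ [c]))) :
    Cocomplete Q R (Q.src c, c :: m) := by
  rw [mem1] at h
  rw [cc_iff]
  refine ⟨by simp, by simp, ?_⟩
  have h1 := List.isChain_append.1 h.1
  refine List.isChain_append.2 ⟨h1.1, h1.1, fun x hx y hy => h1.2.2 x hx y (by simpa using hy)⟩

lemma rot_cob (hg : IsGentle Q R) {v : Q.V} {m : List Q.A} {a c : Q.A}
    (hδ : Cocomplete Q R (v, m ++ [a])) (hc : (m ++ [a]).head? = some c) :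
    bv k Q R 1 (pr Q c ((m ++ [a]) ++ [c])) - bv k Q R 1 (pr Q a (a :: m ++ [a])) ∈
      LinearMap.range (dLin k Q R 0) := by
  classical
  have h1 : GBmem Q R 1 (pr Q c ((m ++ [a]) ++ [c])) := (gbmem_cc hδ hc).2
  have hr := cc_rotP _ hδ
  rw [rotP_append] at hr
  have h2 : GBmem Q R 1 (pr Q a (a :: (m ++ [a]))) := (gbmem_cc hr (c := a) (by simp)).2
  have h0 := mem0_of_left h1
  refine ⟨Finsupp.single ⟨_, h0⟩ 1, ?_⟩
  rw [d0_pt, sumL hg (by simp) h1]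
  have hca : Q.src c = Q.tgt a := by
    rw [mem0] at h0
    exact (h0.2.2 a (by simp)).symm
  rw [hca, sumR hg (by simp) h2]
  simp

lemma typeA_mem (hg : IsGentle Q R) {S : Set (PathDat Q)} (hS : IsCrep Q S (Cocomplete Q R))
    (T : Set Q.A) (i : ℕ) : ∀ (δ : PathDat Q) (c : Q.A), Cocomplete Q R δ →
    δ.2.head? = some c → rotI Q i δ ∈ S → bv k Q R 1 (pr Q c (δ.2 ++ [c])) ∈
      LinearMap.range (dLin k Q R 0) ⊔ Submodule.span k (GenS k Q R T S) := by
  induction i with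
  | zero =>
    intro δ c h hc hδ
    apply Submodule.mem_sup_right
    apply Submodule.subset_span
    obtain ⟨h1, h2⟩ := gbmem_cc h hc
    rw [genS_iff hS]
    exact ⟨c, _, h2, Or.inr (Or.inr (Or.inl ⟨δ, hδ, hc, rfl⟩)), bv_mem _⟩
  | succ i ih =>
    rintro ⟨v, l⟩ c h hc hδ
    rcases List.eq_nil_or_concat l with rfl | ⟨m, a, rfl⟩
    · simp at hc
    · simp only [List.concat_eq_append] at *
      rw [rotI_succ, rotP_append] at hδ
      have hr := cc_rotP _ h
      rw [rotP_append] at hr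
      have := ih _ a hr (by simp) hδ
      have h2 := Submodule.add_mem _ (Submodule.mem_sup_left (T := Submodule.span k (GenS k Q R T S))
        (rot_cob (k := k) hg h hc)) this
      simpa using h2

lemma self_mem {T : Set Q.A} (hT : IsSpanningTree Q T)
    {S : Set (PathDat Q)} (hS : IsCrep Q S (Cocomplete Q R)) (c0 : Q.A) :
    bv k Q R 1 (pr Q c0 [c0]) ∈
      LinearMap.range (dLin k Q R 0) ⊔ Submodule.span k (GenS k Q R T S) := by
  classical
  obtain ⟨y, hy⟩ := tree_solve (k := k) hT (fun c => if c0 = c then 1 else 0)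
  have hnil : ∀ v : Q.V, GBmem Q R 0 (pt Q v []) := fun v => by rw [mem0]; simp
  let Y : Coch k Q R 0 := ∑ v : Q.V, Finsupp.single ⟨pt Q v [], hnil v⟩ (y v)
  have hY : ∀ v l, cf 0 Y (pt Q v l) = if l = [] then y v else 0 := by
    intro v l
    split_ifs with hl
    · subst hl
      rw [cf_mem _ (hnil v)]
      simp only [Y, Finsupp.finset_sum_apply]
      rw [Finset.sum_eq_single v]
      · simp
      · intro w _ hw
        rw [Finsupp.single_apply, if_neg]
        intro h; apply hw
        simpa using h
      · simp
    · unfold cf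
      split_ifs with h
      · simp only [Y, Finsupp.finset_sum_apply]
        apply Finset.sum_eq_zero
        intro w _
        rw [Finsupp.single_apply, if_neg]
        intro h'; apply hl
        have := congrArg (fun x => x.val.2.2) h'
        exact this.symm
      · rfl
  have hw : bv k Q R 1 (pr Q c0 [c0]) - dLin k Q R 0 Y ∈ Submodule.span k (GenS k Q R T S) := by
    apply supp_mem
    intro X hX
    obtain ⟨c, l, he⟩ := exists_pr X
    obtain ⟨X, hm⟩ := X
    simp only at he
    subst he
    apply Submodule.subset_span
    rw [genS_iff hS]
    refine ⟨c, l, hm, ?_, rfl⟩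
    rw [Finsupp.sub_apply, bv_apply, d0_apply, hY, hY] at hX
    by_cases hl : l = [c]
    · subst hl
      left
      refine ⟨fun hc => hX ?_, rfl⟩
      have := hy c hc
      by_cases h : c0 = c
      · subst h
        simp at this ⊢
        rw [this]; simp
      · have h' : ¬ (pr Q c0 [c0] = pr Q c [c]) := by
          intro h2; apply h; simp at h2; exact h2.2
        rw [if_neg h']
        simp [h] at this ⊢
        linear_combination -this
    · exfalso
      apply hX
      rw [if_neg]
      · have e1 : l.getLast? = some c → l.dropLast ≠ [] := by
          intro h1 h2
          have := eq_of_last h1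
          rw [h2] at this
          exact hl this
        have e2 : l.head? = some c → l.tail ≠ [] := by
          intro h1 h2
          have := eq_of_head h1
          rw [h2] at this
          exact hl this
        split_ifs <;> simp_all
      · intro h
        apply hl
        simp only [Prod.mk.injEq, List.cons.injEq, and_true] at h
        obtain ⟨⟨-, h1⟩, -, h2⟩ := h
        rw [← h2, h1]
  have h2 := Submodule.add_mem _ (Submodule.mem_sup_right (S := LinearMap.range (dLin k Q R 0)) hw)
    (Submodule.mem_sup_left (LinearMap.mem_range_self (dLin k Q R 0) Y))
  simpa using h2


/-! Spanning. -/

/-- Pairs `(c, α)` with `α` ending but not beginning with `c`. -/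
def TB (X : GB Q R 1) : Prop :=
  ∃ c l, X.val = pr Q c l ∧ l.getLast? = some c ∧ l.head? ≠ some c

lemma TB_pr {c : Q.A} {l : List Q.A} {h : GBmem Q R 1 (pr Q c l)} :
    TB (⟨_, h⟩ : GB Q R 1) ↔ l.getLast? = some c ∧ l.head? ≠ some c := by
  constructor
  · rintro ⟨c', l', he, h1⟩
    simp only [Prod.mk.injEq, List.cons.injEq, and_true] at he
    obtain ⟨⟨-, rfl⟩, -, rfl⟩ := he
    exact h1
  · intro h1; exact ⟨c, l, rfl, h1⟩

lemma removeB1 (hg : IsGentle Q R) (X : GB Q R 1) : ∃ w : Coch k Q R 1,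
    Finsupp.single X 1 - w ∈ LinearMap.range (dLin k Q R 0) ∧ ∀ X', TB X' → w X' = 0 := by
  classical
  by_cases hX : TB X
  · obtain ⟨c, l, he, h1, h2⟩ := hX
    obtain ⟨X, hm⟩ := X
    simp only at he
    subst he
    generalize hβ : l.dropLast = β
    obtain rfl : l = β ++ [c] := by rw [← hβ]; exact eq_of_last h1
    have hne : β ≠ [] := by rintro rfl; simp at h2
    obtain ⟨f, hf⟩ : ∃ e, β.head? = some e := by
      rw [← Option.isSome_iff_exists]; simpa using hne
    obtain ⟨d, hd⟩ : ∃ e, β.getLast? = some e := by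
      rw [← Option.isSome_iff_exists]; simpa using hne
    have hfc : f ≠ c := by
      rintro rfl
      simp [hf] at h2
    have h0 := mem0_of_left hm
    refine ⟨∑ a : Q.A, if Q.tgt a = Q.src c then bv k Q R 1 (pr Q a (a :: β)) else 0, ?_, ?_⟩
    · refine ⟨Finsupp.single ⟨_, h0⟩ 1, ?_⟩
      rw [d0_pt, sumL hg hne hm, bv_mem hm]
    · intro X' hX'
      rw [Finsupp.finset_sum_apply]
      apply Finset.sum_eq_zero
      intro a _
      split_ifs
      · rw [bv_apply, if_neg]
        intro he
        obtain ⟨X', hm'⟩ := X'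
        simp only at he
        subst he
        rw [TB_pr] at hX'
        simp at hX'
      · rfl
  · refine ⟨Finsupp.single X 1, by simp, ?_⟩
    intro X' hX'
    rw [Finsupp.single_apply, if_neg]
    rintro rfl
    exact hX hX'

lemma removeB (hg : IsGentle Q R) (z : Coch k Q R 1) : ∃ w : Coch k Q R 1,
    z - w ∈ LinearMap.range (dLin k Q R 0) ∧ ∀ X', TB X' → w X' = 0 := by
  induction z using Finsupp.induction_linear with
  | zero => exact ⟨0, by simp, by simp⟩
  | add f g hf hg =>
    obtain ⟨w1, h1, h1'⟩ := hf
    obtain ⟨w2, h2, h2'⟩ := hg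
    refine ⟨w1 + w2, ?_, fun X hX => by simp [h1' X hX, h2' X hX]⟩
    have := Submodule.add_mem _ h1 h2
    rwa [← add_sub_add_comm] at this
  | single X r =>
    obtain ⟨w, h1, h2⟩ := removeB1 (k := k) hg X
    refine ⟨r • w, ?_, fun X hX => by simp [h2 X hX]⟩
    have := Submodule.smul_mem _ r h1
    rw [smul_sub] at this
    simpa using this

lemma typeC_mem (hg : IsGentle Q R) {a : Q.A} {β : List Q.A}
    (hm : GBmem Q R 1 (pr Q a (a :: β))) (hne : β ≠ []) (hla : β.getLast? ≠ some a)
    (hno : ∀ b, (a, b) ∉ R) :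
    bv k Q R 1 (pr Q a (a :: β)) ∈ LinearMap.range (dLin k Q R 0) := by
  classical
  have h0 := mem0_of_right hm
  obtain ⟨d, hd⟩ : ∃ e, β.getLast? = some e := by
    rw [← Option.isSome_iff_exists]; simpa using hne
  refine ⟨- Finsupp.single ⟨_, h0⟩ 1, ?_⟩
  rw [map_neg, d0_pt, sumR hg hne hm, Finset.sum_eq_zero]
  · simp
  · intro b _
    split_ifs with hb
    · apply bv_not
      intro hb'
      rw [mem1] at hb'
      have h1 := chain_last_not hb'.1 hd
      have := hg.uniqNotRelBefore b h1 ⟨hb.symm, hno b⟩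
      exact hla (this ▸ hd)
    · rfl

lemma span_mem (hg : IsGentle Q R) {T : Set Q.A} (hT : IsSpanningTree Q T)
    {S : Set (PathDat Q)} (hS : IsCrep Q S (Cocomplete Q R)) (w : Coch k Q R 1)
    (hd : dLin k Q R 1 w = 0) (hB : ∀ X, TB X → w X = 0) :
    w ∈ LinearMap.range (dLin k Q R 0) ⊔ Submodule.span k (GenS k Q R T S) := by
  classical
  apply supp_mem
  intro X hX
  obtain ⟨c, l, he⟩ := exists_pr X
  obtain ⟨X, hm⟩ := X
  simp only at he
  subst he
  have hm1 := (mem1 c l).1 hm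
  have inGen : GenP k Q R T S c l → Finsupp.single ⟨pr Q c l, hm⟩ 1 ∈
      LinearMap.range (dLin k Q R 0) ⊔ Submodule.span k (GenS k Q R T S) := by
    intro h
    apply Submodule.mem_sup_right
    apply Submodule.subset_span
    rw [genS_iff hS]
    exact ⟨c, l, hm, h, rfl⟩
  by_cases hlast : l.getLast? = some c
  · have hhead : l.head? = some c := by
      by_contra hh
      exact hX (hB _ (TB_pr.2 ⟨hlast, hh⟩))
    rw [← bv_mem hm]
    have hl := eq_of_head hhead
    by_cases ht : l.tail = []
    · rw [ht] at hl
      rw [hl]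
      exact self_mem hT hS c
    · have hl2 : l = c :: l.tail.dropLast ++ [c] := by
        rw [hl, List.getLast?_cons] at hlast
        rcases List.eq_nil_or_concat l.tail with h | ⟨m, a, h⟩
        · exact absurd h ht
        · rw [h] at hlast
          rw [hl, h]
          simpa using hlast
      generalize l.tail.dropLast = m at hl2
      subst hl2
      have hc := cc_of_mem hm
      obtain ⟨i, hi⟩ := S_ex hS hc
      exact typeA_mem hg hS T i _ c hc (by simp) hi
  · by_cases hhead : l.head? = some c
    · have hl := eq_of_head hhead
      generalize l.tail = β at hl
      subst hl
      have hne : β ≠ [] := by rintro rfl; simp at hlast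
      obtain ⟨d, hd'⟩ : ∃ e, β.getLast? = some e := by
        rw [← Option.isSome_iff_exists]; simpa using hne
      have hla : β.getLast? ≠ some c := by
        intro h; apply hlast; rw [List.getLast?_cons, h]; simp
      by_cases hno : ∀ b, (c, b) ∉ R
      · rw [← bv_mem hm]
        exact Submodule.mem_sup_left (typeC_mem hg hm hne hla hno)
      · exfalso
        push Not at hno
        obtain ⟨b, hb⟩ := hno
        have hcb : Q.tgt c = Q.src b := hg.relComposable _ hb
        have hdt : Q.tgt d = Q.tgt c := hm1.2.2.1 d (by rw [List.getLast?_cons, hd']; simp)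
        have hlastc : (c :: β).getLast? = some d := by rw [List.getLast?_cons, hd']; simp
        have e1 : (c :: β ++ [b]).getLast? = some b := by rw [List.getLast?_append]; simp
        have hY : GBmem Q R 2 (pr2 Q c b (c :: β ++ [b])) := by
          rw [mem2 hg]
          refine ⟨hb, ?_, by simp, by intro x hx; rw [e1] at hx; simp at hx; rw [hx], by simp⟩
          refine List.isChain_append.2 ⟨hm1.1, by simp, ?_⟩
          intro x hx y hy
          rw [hlastc] at hx
          simp at hx hy
          subst hx hy
          refine ⟨hdt.trans hcb, fun hR => ?_⟩
          exact hla (hg.uniqRelBefore b ⟨hdt.trans hcb, hR⟩ ⟨hcb, hb⟩ ▸ hd')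
        have h2 := d1_apply w hcb hY
        rw [hd] at h2
        have hYr : GBmem Q R 1 (pr Q b (β ++ [b])) := mem2_right hg hY
        have e2 : (c :: β ++ [b]).dropLast = c :: β := by
          rw [List.dropLast_append_of_ne_nil (by simp)]; simp
        rw [if_pos e1, e2, if_pos (by simp), cf_mem _ hm] at h2
        have e3 : (c :: β ++ [b]).tail = β ++ [b] := rfl
        have hTB : TB (⟨_, hYr⟩ : GB Q R 1) := by
          refine TB_pr.2 ⟨by simp, ?_⟩
          intro hh
          have hbh : β.head? = some b := by
            cases β with
            | nil => exact absurd rfl hne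
            | cons => simpa using hh
          exact (chain_head_not hm1.1 hbh).2 hb
        rw [e3, cf_mem _ hYr, hB _ hTB] at h2
        apply hX
        simpa using h2.symm
    · by_cases hmax : GMax Q R (Q.src c, [c])
      · exact inGen (Or.inr (Or.inl ⟨hmax, hhead, hlast⟩))
      rw [gmax_iff hg, not_and_or] at hmax
      by_cases hcc : l = [] ∧ (c, c) ∈ R
      · obtain ⟨rfl, hcc⟩ := hcc
        have hloop := hm1.2.2.2 rfl
        by_cases hch : ringChar k = 2
        · exact inGen (Or.inr (Or.inr (Or.inr ⟨hch, hloop, hcc, rfl⟩)))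
        exfalso
        have hY : GBmem Q R 2 (pr2 Q c c [c]) := by
          rw [mem2 hg]; simp [hcc]
        have h2 := d1_apply w hloop.symm hY
        rw [hd] at h2
        simp [cf_mem _ hm] at h2
        apply hX
        rw [← two_mul] at h2
        exact (mul_eq_zero.1 h2.symm).resolve_left (Ring.two_ne_zero hch)
      exfalso
      rcases hmax with hmax | hmax
      · push Not at hmax
        obtain ⟨b, hb⟩ := hmax
        have hcb : Q.tgt c = Q.src b := hg.relComposable _ hb
        have hY : GBmem Q R 2 (pr2 Q c b (l ++ [b])) := by
          rw [mem2 hg]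
          refine ⟨hb, ?_, ?_, by intro x hx; simp at hx; rw [hx], by simp⟩
          · refine List.isChain_append.2 ⟨hm1.1, by simp, ?_⟩
            intro x hx y hy
            simp at hy
            subst hy
            have hxt := (hm1.2.2.1 x hx).trans hcb
            refine ⟨hxt, fun hR => ?_⟩
            apply hlast
            rw [hg.uniqRelBefore b ⟨hcb, hb⟩ ⟨hxt, hR⟩]
            exact hx
          · intro x hx
            cases l with
            | nil =>
              simp at hx; subst hx
              rw [hm1.2.2.2 rfl, hcb]
            | cons y l => exact hm1.2.1 x (by simpa using hx)
        have h2 := d1_apply w hcb hY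
        rw [hd, if_pos (by simp), if_neg (c := (l ++ [b]).head? = some c)] at h2
        · simp [cf_mem _ hm] at h2
          exact hX h2.symm
        · intro hh
          cases l with
          | nil =>
            simp at hh; subst hh
            exact hcc ⟨rfl, hb⟩
          | cons y l => exact hhead (by simpa using hh)
      · push Not at hmax
        obtain ⟨a, ha⟩ := hmax
        have hac : Q.tgt a = Q.src c := hg.relComposable _ ha
        have hY : GBmem Q R 2 (pr2 Q a c (a :: l)) := by
          rw [mem2 hg]
          refine ⟨ha, ?_, by simp, ?_, by simp⟩
          · refine List.isChain_cons.2 ⟨?_, hm1.1⟩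
            intro x hx
            have hxt := hac.trans (hm1.2.1 x hx).symm
            refine ⟨hxt, fun hR => ?_⟩
            apply hhead
            rw [hg.uniqRelAfter a ⟨hac, ha⟩ ⟨hxt, hR⟩]
            exact hx
          · intro x hx
            rw [List.getLast?_cons] at hx
            rcases List.eq_nil_or_concat l with rfl | ⟨m, y, rfl⟩
            · simp at hx; subst hx
              rw [← hm1.2.2.2 rfl, hac]
            · exact hm1.2.2.1 x (by simpa using hx)
        have h2 := d1_apply w hac hY
        rw [hd, if_neg, if_pos (by simp)] at h2
        · simp [cf_mem _ hm] at h2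
          exact hX h2.symm
        · intro hh
          rw [List.getLast?_cons] at hh
          rcases List.eq_nil_or_concat l with rfl | ⟨m, y, rfl⟩
          · simp at hh; subst hh
            exact hcc ⟨rfl, ha⟩
          · exact hlast (by simpa using hh)

/-! Independence modulo coboundaries. -/

lemma cob_zero {T : Set Q.A} (hT : IsSpanningTree Q T)
    {S : Set (PathDat Q)} (hS : IsCrep Q S (Cocomplete Q R)) (y : Coch k Q R 0)
    (hy : dLin k Q R 0 y ∈ Submodule.span k (GenS k Q R T S)) : dLin k Q R 0 y = 0 := by
  classical
  ext X
  obtain ⟨c, l, he⟩ := exists_pr X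
  obtain ⟨X, hm⟩ := X
  simp only at he
  subst he
  by_contra hne
  simp only [Finsupp.coe_zero, Pi.zero_apply] at hne
  have hS0 : ∀ δ ∈ S, δ.2 ≠ [] := fun δ hδ => ((cc_iff δ).1 (S_cc hS hδ)).1
  rcases genS_coeff hS hy hm hne with ⟨h1, rfl⟩ | ⟨h1, h2, h3⟩ | ⟨δ, hδ, hc, rfl⟩ | ⟨h1, h2, h3, rfl⟩
  · apply hne
    have hval : ∀ c, dLin k Q R 0 y ⟨_, gbmem_self c⟩ =
        cf 0 y (pt Q (Q.src c) []) - cf 0 y (pt Q (Q.tgt c) []) := by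
      intro c; rw [d0_apply]; simp
    rw [hval, sub_eq_zero]
    apply tree_const hT (fun v => cf 0 y (pt Q v []))
    intro t ht
    rw [← sub_eq_zero, ← hval]
    by_contra hne'
    rcases genS_coeff hS hy _ hne' with ⟨h1, -⟩ | ⟨h1, h2, h3⟩ | ⟨δ, hδ, hc, he⟩ | ⟨h1, h2, h3, he⟩
    · exact h1 ht
    · simp at h2
    · apply hS0 δ hδ
      have := congrArg List.length he
      simpa using this
    · simp at he
  · apply hne
    rw [d0_apply, if_neg h3, if_neg h2, sub_zero]
  · apply hne
    have hcδ := S_cc hS hδ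
    -- the value of the coboundary at a rotated cycle
    have hval : ∀ (v : Q.V) (m : List Q.A) (a : Q.A) (h : Cocomplete Q R (v, m ++ [a])),
        ∀ hm' : GBmem Q R 1 (pr Q a (a :: m ++ [a])),
        dLin k Q R 0 y ⟨_, hm'⟩ =
          cf 0 y (pt Q (Q.src a) (a :: m)) - cf 0 y (pt Q v (m ++ [a])) := by
      intro v m a h hm'
      rw [d0_apply]
      have e1 : (a :: m ++ [a]).dropLast = a :: m := by
        rw [List.dropLast_append_of_ne_nil (by simp)]; simp
      rw [if_pos (by rw [List.getLast?_append]; simp), e1, if_pos (by simp)]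
      have : Q.tgt a = v := by
        have := h.1.2.2
        simp [psrc, ptgt] at this
        exact this.symm
      rw [this]; rfl
    have hconst : ∀ i, cf 0 y (pt Q (rotI Q i δ).1 (rotI Q i δ).2) = cf 0 y (pt Q δ.1 δ.2) := by
      intro i
      induction i with
      | zero => rfl
      | succ i ih =>
        by_cases hi : rotI Q (i+1) δ = δ
        · rw [hi]
        rw [← ih]
        have hci := cc_rotI i δ hcδ
        have hci' := cc_rotI (i+1) δ hcδ
        rw [rotI_succ'] at hi hci' ⊢
        have hsu : rotP Q (rotI Q i δ) ∉ S := by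
          intro hmem
          apply hi
          rw [← rotI_succ'] at hmem ⊢
          exact S_uniq hS hδ _ hmem
        generalize hε : rotI Q i δ = ε at *
        obtain ⟨v, l⟩ := ε
        rcases List.eq_nil_or_concat l with rfl | ⟨m, a, rfl⟩
        · exact absurd rfl ((cc_iff _).1 hci).1
        simp only [List.concat_eq_append] at *
        rw [rotP_append] at hci' hsu ⊢
        have hmm : GBmem Q R 1 (pr Q a (a :: m ++ [a])) := (gbmem_cc hci' (c := a) (by simp)).2
        rw [← sub_eq_zero, ← hval v m a hci hmm]
        by_contra hne'
        rcases genS_coeff hS hy _ hne' with ⟨h1, he⟩ | ⟨h1, h2, h3⟩ | ⟨δ', hδ', hc', he⟩ |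
          ⟨h1, h2, h3, he⟩
        · simp at he
        · simp at h2
        · have : δ' = (Q.src a, a :: m) :=
            cc_ext (S_cc hS hδ') hci' (List.append_cancel_right he).symm
          exact hsu (this ▸ hδ')
        · simp at he
    obtain ⟨v, l⟩ := δ
    obtain ⟨m, rfl⟩ : ∃ m, l = c :: m := ⟨_, eq_of_head hc⟩
    have hv : Q.src c = v := (gbmem_cc hcδ hc).1
    subst hv
    -- the cycle preceding `δ` in its rotation class
    have hlen := rotI_length _ hcδ
    simp only [List.length_cons] at hlen
    rw [rotI_succ'] at hlen
    have hcp := cc_rotI m.length _ hcδ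
    have hk := hconst m.length
    generalize rotI Q m.length (Q.src c, c :: m) = ε at *
    obtain ⟨v, l⟩ := ε
    rcases List.eq_nil_or_concat l with rfl | ⟨m', a, rfl⟩
    · exact absurd rfl ((cc_iff _).1 hcp).1
    simp only [List.concat_eq_append] at *
    rw [rotP_append] at hlen
    simp only [Prod.mk.injEq, List.cons.injEq] at hlen
    obtain ⟨-, rfl, rfl⟩ := hlen
    rw [hval v m' a hcp hm, hk, sub_self]
  · apply hne
    rw [d0_apply]; simp

theorem main_aux (hg : IsGentle Q R) {T : Set Q.A} (hT : IsSpanningTree Q T)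
    {S : Set (PathDat Q)} (hS : IsCrep Q S (Cocomplete Q R)) :
    FreelyGeneratesCohom k Q R 0 (GenS k Q R T S) := by
  refine ⟨?_, ?_, ?_, ?_⟩
  · intro x hx
    obtain ⟨c, l, h, hP, rfl⟩ := (genS_iff hS x).1 hx
    exact gen_cocycle hg h hP
  · intro z hz
    obtain ⟨w, ⟨y, hy⟩, hB⟩ := removeB hg z
    have hw : dLin k Q R 1 w = 0 := by
      have h1 : w = z - dLin k Q R 0 y := by rw [hy]; abel
      have h2 : dLin k Q R 1 z = 0 := hz
      rw [h1, map_sub, h2, dd0 hg, sub_zero]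
    obtain ⟨u, ⟨y', rfl⟩, s, hs, he⟩ := Submodule.mem_sup.1 (span_mem hg hT hS w hw hB)
    refine ⟨y + y', ?_⟩
    have : z - dLin k Q R 0 (y + y') = s := by
      rw [map_add, hy, ← he]; abel_nf
    rw [this]
    exact hs
  · rintro x hx ⟨y, rfl⟩
    exact cob_zero hT hS y hx
  · have hb := (Finsupp.basisSingleOne (R := k) (ι := GB Q R 1)).linearIndependent
    have h1 := hb.linearIndepOn_id
    have hsub : GenS k Q R T S ⊆ Set.range
        (Finsupp.basisSingleOne (R := k) (ι := GB Q R 1)) := by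
      intro x hx
      obtain ⟨c, l, h, hP, rfl⟩ := (genS_iff hS x).1 hx
      exact ⟨⟨_, h⟩, by simp⟩
    exact h1.mono hsub

end Helpers

/-- For a gentle presentation `(Q, R)` and a spanning tree `T`
of `Q`, the first cohomology `HH¹` of `k(Γ ∥ B)` is freely generated by the
classes of: the pairs `(c, c)` with `c ∈ Q₁ \ T`; the pairs `(c, α)` with `c` a
`Γ`-maximal arrow and `α ∈ B` neither beginning nor ending with `c`; the pairs
`(c, cδ)` with `δ ∈ Crep(B)` and `c` the first arrow of `δ`; and, if
`char k = 2`, the pairs `(b, s(b))` with `b` a loop with `b² ∈ R`. -/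
theorem hh1_basis (k : Type) [Field k] (Q : Quiv) (R : Set (Q.A × Q.A))
    (hg : IsGentle Q R) (T : Set Q.A) (hT : IsSpanningTree Q T)
    (S : Set (PathDat Q)) (hS : IsCrep Q S (Cocomplete Q R)) :
    FreelyGeneratesCohom k Q R 0
      ({x | ∃ c : Q.A, c ∉ T ∧ x = bv k Q R 1 ((Q.src c, [c]), (Q.src c, [c]))} ∪
       {x | ∃ (c : Q.A) (α : PathDat Q), GMax Q R (Q.src c, [c]) ∧
            GBmem Q R 1 ((Q.src c, [c]), α) ∧
            α.2.head? ≠ some c ∧ α.2.getLast? ≠ some c ∧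
            x = bv k Q R 1 ((Q.src c, [c]), α)} ∪
       {x | ∃ δ ∈ S, ∃ c : Q.A, δ.2.head? = some c ∧
            x = bv k Q R 1 ((Q.src c, [c]), (δ.1, δ.2 ++ [c]))} ∪
       {x | ringChar k = 2 ∧ ∃ b : Q.A, Q.src b = Q.tgt b ∧ (b, b) ∈ R ∧
            x = bv k Q R 1 ((Q.src b, [b]), (Q.src b, []))}) := by
  exact main_aux hg hT hS

end GentleTT
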